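/- arXiv:2105.04712 — 9 statements merged into one kernel-verified Lean document; each statement's English description precedes it below -/
import Mathlib

section
/- There exists a universal constant C ≥ 1 such that the following holds. Let p ≥ q ≥ 1 be reals, let d ≥ 1, let P be a finite set of n points in ℝ^d, and let t ∈ ℝ^d satisfy, for every coordinate i ∈ {1,...,d}, |{x ∈ P : x_i < t_i}| = |{x ∈ P : x_i > t_i}|. Define g : ℝ^d → ℝ^d by g(x) = M̃_{p,q}(x − t). Then (i) ‖g(x) − g(y)‖_q ≤ C·(p/q)·‖x − y‖_p for all x, y ∈ ℝ^d, and (ii) Σ_{x∈P} Σ_{y∈P} ‖g(x) − g(y)‖_q^q ≥ C^{−q} · Σ_{x∈P} Σ_{y∈P} ‖x − y‖_p^q. In particular, g is an embedding of ℓ_p^d into ℓ_q^d with q-average distortion O(p/q) with respect to P. -/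
open Finset
open scoped Classical

/-- The ℓ_p norm on ℝ^d (for a real exponent p). -/
noncomputable def lpNorm (p : ℝ) {d : ℕ} (x : Fin d → ℝ) : ℝ :=
  (∑ i, |x i| ^ p) ^ (1 / p)

/-- The Mazur map `M_{p,q}`, defined coordinatewise by
`M_{p,q}(x)_i = sign(x_i) |x_i|^(p/q)`. -/
noncomputable def mazurMap (p q : ℝ) {d : ℕ} (x : Fin d → ℝ) : Fin d → ℝ :=
  fun i => Real.sign (x i) * |x i| ^ (p / q)

/-- The rescaled Mazur map `M̃_{p,q}(x) = ‖x‖_p^{1-p/q} M_{p,q}(x)`, with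
`M̃_{p,q}(0) = 0`. -/
noncomputable def rescaledMazurMap (p q : ℝ) {d : ℕ} (x : Fin d → ℝ) : Fin d → ℝ :=
  if x = 0 then 0 else lpNorm p x ^ (1 - p / q) • mazurMap p q x

lemma lpNorm_nonneg' (p : ℝ) {d : ℕ} (x : Fin d → ℝ) : 0 ≤ lpNorm p x := by
  unfold lpNorm
  exact Real.rpow_nonneg (Finset.sum_nonneg fun i _ => Real.rpow_nonneg (abs_nonneg _) _) _

lemma lpNorm_rpow {p : ℝ} (hp : 1 ≤ p) {d : ℕ} (x : Fin d → ℝ) :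
    lpNorm p x ^ p = ∑ i, |x i| ^ p := by
  unfold lpNorm
  rw [← Real.rpow_mul (Finset.sum_nonneg fun i _ => Real.rpow_nonneg (abs_nonneg _) _),
    one_div_mul_cancel (by linarith), Real.rpow_one]

lemma lpNorm_neg' (p : ℝ) {d : ℕ} (x : Fin d → ℝ) : lpNorm p (-x) = lpNorm p x := by
  simp [lpNorm]

lemma lpNorm_sub_comm' (p : ℝ) {d : ℕ} (x y : Fin d → ℝ) :
    lpNorm p (x - y) = lpNorm p (y - x) := by
  rw [← lpNorm_neg', neg_sub]

lemma lpNorm_add_le' {p : ℝ} (hp : 1 ≤ p) {d : ℕ} (x y : Fin d → ℝ) :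
    lpNorm p (x + y) ≤ lpNorm p x + lpNorm p y :=
  Real.Lp_add_le _ _ _ hp

lemma lpNorm_smul' {p : ℝ} (hp : 1 ≤ p) {d : ℕ} (c : ℝ) (x : Fin d → ℝ) :
    lpNorm p (c • x) = |c| * lpNorm p x := by
  unfold lpNorm
  simp only [Pi.smul_apply, smul_eq_mul, abs_mul]
  simp_rw [Real.mul_rpow (abs_nonneg c) (abs_nonneg _)]
  rw [← Finset.mul_sum, Real.mul_rpow (Real.rpow_nonneg (abs_nonneg c) _)
    (Finset.sum_nonneg fun i _ => Real.rpow_nonneg (abs_nonneg _) _),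
    ← Real.rpow_mul (abs_nonneg c), mul_one_div_cancel (by linarith), Real.rpow_one]

lemma lpNorm_eq_zero' {p : ℝ} (hp : 1 ≤ p) {d : ℕ} (x : Fin d → ℝ) (h : lpNorm p x = 0) :
    x = 0 := by
  have h1 := lpNorm_rpow hp x
  rw [h, Real.zero_rpow (by linarith)] at h1
  have h2 := (Finset.sum_eq_zero_iff_of_nonneg
    (fun i _ => Real.rpow_nonneg (abs_nonneg (x i)) p)).1 h1.symm
  ext i
  have h3 := h2 i (Finset.mem_univ i)
  rw [Real.rpow_eq_zero (abs_nonneg _) (by linarith)] at h3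
  simpa using h3

lemma abs_sgnpow {α : ℝ} (hα : 1 ≤ α) (x : ℝ) : |Real.sign x * |x| ^ α| = |x| ^ α := by
  rw [abs_mul, abs_of_nonneg (Real.rpow_nonneg (abs_nonneg x) α)]
  rcases lt_trichotomy x 0 with h | h | h
  · simp [Real.sign_of_neg h]
  · subst h
    simp [Real.zero_rpow (show α ≠ 0 by linarith)]
  · simp [Real.sign_of_pos h]

lemma lpNorm_mazur {p q : ℝ} (hq : 1 ≤ q) (hpq : q ≤ p) {d : ℕ} (x : Fin d → ℝ) :
    lpNorm q (mazurMap p q x) = lpNorm p x ^ (p / q) := by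
  have hα : 1 ≤ p / q := by rw [le_div_iff₀ (by linarith)]; linarith
  have hq0 : q ≠ 0 := by linarith
  have hp0 : p ≠ 0 := by linarith
  unfold lpNorm mazurMap
  simp_rw [abs_sgnpow hα]
  simp_rw [← Real.rpow_mul (abs_nonneg _)]
  rw [← Real.rpow_mul (Finset.sum_nonneg fun i _ => Real.rpow_nonneg (abs_nonneg _) _)]
  rw [show p / q * q = p by field_simp, show 1 / p * (p / q) = 1 / q by field_simp]

lemma rescaled_eq (p q : ℝ) {d : ℕ} (x : Fin d → ℝ) :
    rescaledMazurMap p q x = lpNorm p x ^ (1 - p / q) • mazurMap p q x := by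
  unfold rescaledMazurMap
  split_ifs with h
  · subst h
    ext i
    simp [mazurMap]
  · rfl

lemma rpow_aux {α b : ℝ} (hα : 1 ≤ α) (hb : 0 ≤ b) : b ^ (1 - α) * b ^ α = b := by
  rw [← Real.rpow_add' hb (by norm_num)]
  simp

lemma lpNorm_rescaled {p q : ℝ} (hq : 1 ≤ q) (hpq : q ≤ p) {d : ℕ} (x : Fin d → ℝ) :
    lpNorm q (rescaledMazurMap p q x) = lpNorm p x := by
  have hα : 1 ≤ p / q := by rw [le_div_iff₀ (by linarith)]; linarith
  rw [rescaled_eq, lpNorm_smul' hq, lpNorm_mazur hq hpq,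
    abs_of_nonneg (Real.rpow_nonneg (lpNorm_nonneg' _ _) _), rpow_aux hα (lpNorm_nonneg' _ _)]

lemma sgnpow_neg (α x : ℝ) : Real.sign (-x) * |-x| ^ α = -(Real.sign x * |x| ^ α) := by
  rw [abs_neg]
  rcases lt_trichotomy x 0 with h | h | h
  · simp [Real.sign_of_neg h, Real.sign_of_pos (neg_pos.2 h)]
  · subst h
    simp
  · simp [Real.sign_of_pos h, Real.sign_of_neg (neg_lt_zero.2 h)]

/-- scalar estimate, `0 < x`, `|y| ≤ x`. -/
lemma scalar1 {α x y : ℝ} (hα : 1 ≤ α) (hx : 0 < x) (hy : |y| ≤ x) :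
    |Real.sign x * |x| ^ α - Real.sign y * |y| ^ α| ≤ α * (x ^ α * (|x - y| / x)) := by
  have hxa : 0 < x ^ α := Real.rpow_pos_of_pos hx α
  obtain ⟨hy1, hy2⟩ := abs_le.1 hy
  have hyx : |y| ^ α ≤ x ^ α := Real.rpow_le_rpow (abs_nonneg y) hy (by linarith)
  have key : ∀ u, 0 ≤ u → u ≤ x → |u| ^ α = x ^ α * (u / x) ^ α := by
    intro u hu _
    rw [← Real.mul_rpow hx.le (by positivity), mul_div_cancel₀ _ hx.ne', abs_of_nonneg hu]
  rw [Real.sign_of_pos hx, abs_of_pos hx, one_mul, abs_of_nonneg (show 0 ≤ x - y by linarith)]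
  have e : (x - y) / x = 1 - y / x := by field_simp
  rw [e]
  have hr : y / x ≤ 1 := by rw [div_le_one hx]; exact hy2
  rcases lt_trichotomy y 0 with h | h | h
  · rw [Real.sign_of_neg h, abs_of_nonneg (by
      have := Real.rpow_nonneg (abs_nonneg y) α
      linarith)]
    have h1 := key (-y) (by linarith) (by linarith)
    rw [abs_neg] at h1
    rw [h1]
    have h0 : 0 ≤ -y / x := div_nonneg (by linarith) hx.le
    have h2 : (-y / x) ^ α ≤ (-y / x) ^ (1 : ℝ) :=
      Real.rpow_le_rpow_of_exponent_ge_of_imp h0 (by rw [div_le_one hx]; linarith) hα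
        (fun _ h => absurd h (by norm_num; linarith))
    rw [Real.rpow_one] at h2
    have e2 : y / x = - (-y / x) := by ring
    rw [e2]
    generalize -y / x = r at *
    have : x ^ α * (1 + r ^ α) ≤ x ^ α * (α * (1 + r)) := by
      apply mul_le_mul_of_nonneg_left _ hxa.le
      nlinarith
    linarith
  · subst h
    simp
    rw [abs_of_pos hxa]
    nlinarith
  · rw [Real.sign_of_pos h, one_mul, abs_of_nonneg (by linarith), key y h.le hy2]
    have h0 : 0 ≤ y / x := div_nonneg h.le hx.le
    have := one_add_mul_self_le_rpow_one_add (s := y / x - 1) (by linarith) hα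
    rw [add_sub_cancel] at this
    have : x ^ α * (1 - (y / x) ^ α) ≤ x ^ α * (α * (1 - y / x)) := by
      apply mul_le_mul_of_nonneg_left _ hxa.le
      linarith
    linarith

lemma scalar2 {α x y : ℝ} (hα : 1 ≤ α) (hy : |y| ≤ |x|) :
    |Real.sign x * |x| ^ α - Real.sign y * |y| ^ α| ≤ α * (|x| ^ α * (|x - y| / |x|)) := by
  rcases lt_trichotomy x 0 with h | h | h
  · have := scalar1 (x := -x) (y := -y) hα (by linarith) (by
      rw [abs_neg]; rwa [abs_of_neg h] at hy)
    rw [sgnpow_neg, sgnpow_neg, show -x - -y = -(x - y) by ring, abs_neg,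
      ← abs_neg, ← abs_of_neg h] at this
    convert this using 2
    ring
  · subst h
    have : y = 0 := by simpa using hy
    subst this
    simp
  · rw [abs_of_pos h] at hy
    have := scalar1 hα h hy
    rwa [abs_of_pos h] at *

lemma scalar3 {α : ℝ} (x y : ℝ) (hα : 1 ≤ α) :
    |Real.sign x * |x| ^ α - Real.sign y * |y| ^ α| ≤
      α * ((max |x| |y|) ^ α * (|x - y| / max |x| |y|)) := by
  rcases le_total |y| |x| with h | h
  · rw [max_eq_left h]; exact scalar2 hα h
  · rw [max_eq_right h, abs_sub_comm, abs_sub_comm x y]; exact scalar2 hα h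

lemma mazur_diff {p q : ℝ} (hq : 1 ≤ q) (hpq : q ≤ p) {d : ℕ} (x y : Fin d → ℝ)
    (hxy : lpNorm p y ≤ lpNorm p x) :
    lpNorm q (mazurMap p q x - mazurMap p q y) ≤
      2 * (p / q) * lpNorm p x ^ (p / q - 1) * lpNorm p (x - y) := by
  have hq0 : 0 < q := by linarith
  have hp0 : 0 < p := by linarith
  have hα : 1 ≤ p / q := by rw [le_div_iff₀ (by linarith)]; linarith
  set α := p / q with hαd
  have hα0 : 0 < α := by linarith
  have hαq : α * q = p := by rw [hαd]; field_simp
  set m : Fin d → ℝ := fun i => max |x i| |y i| with hm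
  have hm0 : ∀ i, 0 ≤ m i := fun i => le_max_of_le_left (abs_nonneg _)
  set a := lpNorm p x with ha
  have ha0 : 0 ≤ a := lpNorm_nonneg' _ _
  set D := lpNorm p (x - y) with hD
  have hD0 : 0 ≤ D := lpNorm_nonneg' _ _
  have h1 : ∀ i, |(mazurMap p q x - mazurMap p q y) i| ^ q ≤
      α ^ q * (m i ^ p * (|x i - y i| / m i) ^ q) := by
    intro i
    have := scalar3 (x i) (y i) hα
    have h2 := Real.rpow_le_rpow (abs_nonneg _) this hq0.le
    have h3 : 0 ≤ |x i - y i| / m i := div_nonneg (abs_nonneg _) (hm0 i)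
    rw [Real.mul_rpow hα0.le (mul_nonneg (Real.rpow_nonneg (hm0 i) _) h3),
      Real.mul_rpow (Real.rpow_nonneg (hm0 i) _) h3, ← Real.rpow_mul (hm0 i), hαq] at h2
    exact h2
  have h2 := Finset.sum_le_sum (s := Finset.univ) (fun i _ => h1 i)
  rw [← lpNorm_rpow hq, ← Finset.mul_sum] at h2
  have h3 := Real.inner_le_weight_mul_Lp_of_nonneg Finset.univ hα (fun i => m i ^ p)
    (fun i => (|x i - y i| / m i) ^ q) (fun i => Real.rpow_nonneg (hm0 i) _)
    (fun i => Real.rpow_nonneg (div_nonneg (abs_nonneg _) (hm0 i)) _)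
  have h4 : ∑ i, m i ^ p ≤ 2 * a ^ p := by
    calc ∑ i, m i ^ p ≤ ∑ i, (|x i| ^ p + |y i| ^ p) := by
          apply Finset.sum_le_sum
          intro i _
          have e1 := Real.rpow_nonneg (abs_nonneg (x i)) p
          have e2 := Real.rpow_nonneg (abs_nonneg (y i)) p
          rcases max_choice |x i| |y i| with h | h <;> simp only [hm, h] <;> linarith
      _ = a ^ p + lpNorm p y ^ p := by
          rw [Finset.sum_add_distrib, ← lpNorm_rpow (by linarith), ← lpNorm_rpow (by linarith)]
      _ ≤ 2 * a ^ p := by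
          have := Real.rpow_le_rpow (lpNorm_nonneg' p y) hxy hp0.le
          linarith
  have h5 : ∑ i, m i ^ p * ((|x i - y i| / m i) ^ q) ^ α ≤ D ^ p := by
    rw [hD, lpNorm_rpow (by linarith)]
    apply Finset.sum_le_sum
    intro i _
    have h3 : 0 ≤ |x i - y i| / m i := div_nonneg (abs_nonneg _) (hm0 i)
    rw [← Real.rpow_mul h3, mul_comm q, hαq, ← Real.mul_rpow (hm0 i) h3]
    apply Real.rpow_le_rpow (mul_nonneg (hm0 i) h3) _ hp0.le
    rw [mul_comm]
    rcases (hm0 i).eq_or_lt with h | h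
    · rw [← h, mul_zero]
      exact abs_nonneg _
    · rw [div_mul_cancel₀ _ h.ne']
      rfl
  have hinv : 0 ≤ 1 - α⁻¹ := by
    have := inv_le_one_of_one_le₀ hα
    linarith
  have h6 : lpNorm q (mazurMap p q x - mazurMap p q y) ^ q ≤
      α ^ q * ((2 * a ^ p) ^ (1 - α⁻¹) * (D ^ p) ^ α⁻¹) := by
    refine h2.trans (mul_le_mul_of_nonneg_left (h3.trans ?_) (Real.rpow_nonneg hα0.le _))
    apply mul_le_mul
    · exact Real.rpow_le_rpow (Finset.sum_nonneg fun i _ => Real.rpow_nonneg (hm0 i) _) h4 hinv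
    · exact Real.rpow_le_rpow (Finset.sum_nonneg fun i _ => mul_nonneg (Real.rpow_nonneg (hm0 i) _)
        (Real.rpow_nonneg (Real.rpow_nonneg (div_nonneg (abs_nonneg _) (hm0 i)) _) _)) h5
        (inv_nonneg.2 hα0.le)
    · exact Real.rpow_nonneg (Finset.sum_nonneg fun i _ => mul_nonneg (Real.rpow_nonneg (hm0 i) _)
        (Real.rpow_nonneg (Real.rpow_nonneg (div_nonneg (abs_nonneg _) (hm0 i)) _) _)) _
    · exact Real.rpow_nonneg (by positivity) _
  have h7 : (2 * a ^ p) ^ (1 - α⁻¹) * (D ^ p) ^ α⁻¹ ≤ 2 ^ q * ((a ^ (α - 1)) ^ q * D ^ q) := by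
    rw [Real.mul_rpow (by norm_num) (by positivity), ← Real.rpow_mul ha0, ← Real.rpow_mul hD0,
      ← Real.rpow_mul ha0]
    have e1 : p * (1 - α⁻¹) = (α - 1) * q := by rw [← hαq]; field_simp
    have e2 : p * α⁻¹ = q := by rw [← hαq]; field_simp
    rw [e1, e2, mul_assoc]
    apply mul_le_mul_of_nonneg_right _ (by positivity)
    apply Real.rpow_le_rpow_of_exponent_le (by norm_num)
    have := inv_pos.2 hα0
    linarith
  have h8 : lpNorm q (mazurMap p q x - mazurMap p q y) ^ q ≤
      (2 * α * a ^ (α - 1) * D) ^ q := by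
    refine h6.trans ((mul_le_mul_of_nonneg_left h7 (by positivity)).trans (le_of_eq ?_))
    rw [Real.mul_rpow (by positivity) hD0, Real.mul_rpow (by positivity) (by positivity),
      Real.mul_rpow (by positivity) hα0.le]
    ring
  exact (Real.rpow_le_rpow_iff (lpNorm_nonneg' _ _) (by positivity) hq0).1 h8

lemma lipschitz_aux {p q : ℝ} (hq : 1 ≤ q) (hpq : q ≤ p) {d : ℕ} (x y : Fin d → ℝ)
    (hxy : lpNorm p y ≤ lpNorm p x) :
    lpNorm q (rescaledMazurMap p q x - rescaledMazurMap p q y) ≤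
      3 * (p / q) * lpNorm p (x - y) := by
  have hp : 1 ≤ p := by linarith
  have hα : 1 ≤ p / q := by rw [le_div_iff₀ (by linarith)]; linarith
  have hD0 := lpNorm_nonneg' p (x - y)
  have hb0 := lpNorm_nonneg' p y
  rcases (lpNorm_nonneg' p x).eq_or_lt with h0 | ha
  · have hx := lpNorm_eq_zero' hp x h0.symm
    have hy := lpNorm_eq_zero' hp y (le_antisymm (by linarith) (lpNorm_nonneg' _ _))
    subst hx
    subst hy
    rw [sub_self]
    have : lpNorm q (0 : Fin d → ℝ) = 0 := by
      have := lpNorm_smul' hq 0 (0 : Fin d → ℝ)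
      simpa using this
    rw [this]
    positivity
  have hM := mazur_diff hq hpq x y hxy
  have hN := lpNorm_mazur hq hpq y
  have htri : lpNorm p x ≤ lpNorm p (x - y) + lpNorm p y := by
    have := lpNorm_add_le' hp (x - y) y
    rwa [sub_add_cancel] at this
  rw [rescaled_eq, rescaled_eq]
  set a := lpNorm p x
  set b := lpNorm p y
  set D := lpNorm p (x - y)
  set α := p / q
  have e : a ^ (1 - α) • mazurMap p q x - b ^ (1 - α) • mazurMap p q y =
      a ^ (1 - α) • (mazurMap p q x - mazurMap p q y) +
        (a ^ (1 - α) - b ^ (1 - α)) • mazurMap p q y := by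
    rw [smul_sub, sub_smul]; abel
  rw [e]
  refine (lpNorm_add_le' hq _ _).trans ?_
  rw [lpNorm_smul' hq, lpNorm_smul' hq, hN, abs_of_pos (Real.rpow_pos_of_pos ha _)]
  have hA : a ^ (1 - α) * lpNorm q (mazurMap p q x - mazurMap p q y) ≤ 2 * α * D := by
    refine (mul_le_mul_of_nonneg_left hM (Real.rpow_pos_of_pos ha _).le).trans (le_of_eq ?_)
    have : a ^ (1 - α) * a ^ (α - 1) = 1 := by
      rw [← Real.rpow_add ha]; simp
    linear_combination (2 * α * D) * this
  have hB : |a ^ (1 - α) - b ^ (1 - α)| * b ^ α ≤ α * D := by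
    have hbα : 0 ≤ b ^ α := Real.rpow_nonneg hb0 _
    rw [← abs_of_nonneg hbα, ← abs_mul, sub_mul, rpow_aux hα hb0]
    have e3 : a ^ (1 - α) * b ^ α = a * (b / a) ^ α := by
      rw [Real.div_rpow hb0 ha.le, Real.rpow_sub ha, Real.rpow_one]; ring
    rw [e3]
    have hs0 : 0 ≤ b / a := div_nonneg hb0 ha.le
    have hs1 : b / a ≤ 1 := by rw [div_le_one ha]; exact hxy
    have hbern := one_add_mul_self_le_rpow_one_add (s := b / a - 1) (by linarith) hα
    rw [add_sub_cancel] at hbern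
    have hb2 : a * (1 + α * (b / a - 1)) ≤ a * (b / a) ^ α :=
      mul_le_mul_of_nonneg_left hbern ha.le
    have hb3 : a * (1 + α * (b / a - 1)) = a + α * (b - a) := by field_simp
    have hs2 : (b / a) ^ α ≤ b / a := by
      have := Real.rpow_le_rpow_of_exponent_ge_of_imp hs0 hs1 hα
        (fun _ h => absurd h (by norm_num; linarith))
      rwa [Real.rpow_one] at this
    have hb4 : a * (b / a) ^ α ≤ a * (b / a) := mul_le_mul_of_nonneg_left hs2 ha.le
    rw [mul_div_cancel₀ _ ha.ne'] at hb4
    rw [abs_of_nonpos (by linarith)]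
    nlinarith
  linarith

lemma lipschitz {p q : ℝ} (hq : 1 ≤ q) (hpq : q ≤ p) {d : ℕ} (x y : Fin d → ℝ) :
    lpNorm q (rescaledMazurMap p q x - rescaledMazurMap p q y) ≤
      3 * (p / q) * lpNorm p (x - y) := by
  rcases le_total (lpNorm p y) (lpNorm p x) with h | h
  · exact lipschitz_aux hq hpq x y h
  · rw [lpNorm_sub_comm', lpNorm_sub_comm' p]
    exact lipschitz_aux hq hpq y x h

lemma median_half {β : Type*} (P : Finset β) (a : β → ℝ)
    (h : (P.filter fun x => a x < 0).card = (P.filter fun x => 0 < a x).card)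
    {q : ℝ} (hq : 1 ≤ q) (x : β) (hx : 0 < a x) :
    (P.card : ℝ) / 2 * |a x| ^ q ≤ ∑ y ∈ P, |a x - a y| ^ q := by
  have hc : (P.filter fun x => 0 < a x).card + (P.filter fun x => ¬ 0 < a x).card = P.card :=
    Finset.card_filter_add_card_filter_not _
  have hle : (P.filter fun x => a x < 0).card ≤ (P.filter fun x => ¬ 0 < a x).card := by
    apply Finset.card_le_card
    intro y hy
    simp only [Finset.mem_filter] at hy ⊢
    exact ⟨hy.1, not_lt.2 hy.2.le⟩
  have hc2 : (P.card : ℝ) ≤ 2 * ((P.filter fun x => ¬ 0 < a x).card : ℝ) := by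
    exact_mod_cast (by omega : P.card ≤ 2 * (P.filter fun x => ¬ 0 < a x).card)
  have hp := Real.rpow_nonneg (abs_nonneg (a x)) q
  calc (P.card : ℝ) / 2 * |a x| ^ q
      ≤ ((P.filter fun x => ¬ 0 < a x).card : ℝ) * |a x| ^ q :=
        mul_le_mul_of_nonneg_right (by linarith) hp
    _ = ∑ y ∈ P.filter (fun x => ¬ 0 < a x), |a x| ^ q := by
        rw [Finset.sum_const, nsmul_eq_mul]
    _ ≤ ∑ y ∈ P.filter (fun x => ¬ 0 < a x), |a x - a y| ^ q := by
        apply Finset.sum_le_sum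
        intro y hy
        have := not_lt.1 (Finset.mem_filter.1 hy).2
        apply Real.rpow_le_rpow (abs_nonneg _) _ (by linarith)
        rw [abs_of_pos hx, abs_of_pos (by linarith)]
        linarith
    _ ≤ ∑ y ∈ P, |a x - a y| ^ q :=
        Finset.sum_le_sum_of_subset_of_nonneg (Finset.filter_subset _ _)
          (fun y _ _ => Real.rpow_nonneg (abs_nonneg _) _)

lemma median_sum {β : Type*} (P : Finset β) (a : β → ℝ)
    (h : (P.filter fun x => a x < 0).card = (P.filter fun x => 0 < a x).card)
    {q : ℝ} (hq : 1 ≤ q) (x : β) :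
    (P.card : ℝ) / 2 * |a x| ^ q ≤ ∑ y ∈ P, |a x - a y| ^ q := by
  rcases lt_trichotomy (a x) 0 with hx | hx | hx
  · have := median_half P (fun x => - a x) (by simpa using h.symm) hq x (by simpa using hx)
    simp only [abs_neg] at this
    refine this.trans (le_of_eq (Finset.sum_congr rfl fun y _ => ?_))
    rw [← abs_neg]
    congr 2
    ring
  · rw [hx, abs_zero, Real.zero_rpow (by linarith), mul_zero]
    exact Finset.sum_nonneg fun y _ => Real.rpow_nonneg (abs_nonneg _) _
  · exact median_half P a h hq x hx

lemma rescaled_pos {p q : ℝ} (hp : 1 ≤ p) {d : ℕ} (x : Fin d → ℝ) (i : Fin d)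
    (hx : 0 < x i) : 0 < rescaledMazurMap p q x i := by
  rw [rescaled_eq]
  have hn : 0 < lpNorm p x := by
    refine (lpNorm_nonneg' p x).lt_of_ne' fun h => ?_
    rw [lpNorm_eq_zero' hp x h] at hx
    simp at hx
  simp only [Pi.smul_apply, smul_eq_mul, mazurMap, Real.sign_of_pos hx, one_mul]
  exact mul_pos (Real.rpow_pos_of_pos hn _) (Real.rpow_pos_of_pos (abs_pos.2 hx.ne') _)

lemma rescaled_neg {p q : ℝ} (hp : 1 ≤ p) {d : ℕ} (x : Fin d → ℝ) (i : Fin d)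
    (hx : x i < 0) : rescaledMazurMap p q x i < 0 := by
  rw [rescaled_eq]
  have hn : 0 < lpNorm p x := by
    refine (lpNorm_nonneg' p x).lt_of_ne' fun h => ?_
    rw [lpNorm_eq_zero' hp x h] at hx
    simp at hx
  simp only [Pi.smul_apply, smul_eq_mul, mazurMap, Real.sign_of_neg hx]
  have := mul_pos (Real.rpow_pos_of_pos hn (1 - p / q))
    (Real.rpow_pos_of_pos (abs_pos.2 hx.ne) (p / q))
  linarith

lemma rescaled_zero (p q : ℝ) {d : ℕ} (x : Fin d → ℝ) (i : Fin d)
    (hx : x i = 0) : rescaledMazurMap p q x i = 0 := by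
  rw [rescaled_eq]
  simp [mazurMap, hx]

lemma add_rpow_le_aux {q a b : ℝ} (hq : 1 ≤ q) (ha : 0 ≤ a) (hb : 0 ≤ b) :
    (a + b) ^ q ≤ 2 ^ q * (a ^ q + b ^ q) := by
  have h2 : (0 : ℝ) ≤ 2 ^ q := by positivity
  have haq : 0 ≤ a ^ q := by positivity
  have hbq : 0 ≤ b ^ q := by positivity
  rcases le_total a b with h | h
  · calc (a + b) ^ q ≤ (2 * b) ^ q :=
          Real.rpow_le_rpow (by linarith) (by linarith) (by linarith)
      _ = 2 ^ q * b ^ q := Real.mul_rpow (by norm_num) hb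
      _ ≤ _ := mul_le_mul_of_nonneg_left (by linarith) h2
  · calc (a + b) ^ q ≤ (2 * a) ^ q :=
          Real.rpow_le_rpow (by linarith) (by linarith) (by linarith)
      _ = 2 ^ q * a ^ q := Real.mul_rpow (by norm_num) ha
      _ ≤ _ := mul_le_mul_of_nonneg_left (by linarith) h2

lemma average {p q : ℝ} (hq : 1 ≤ q) (hpq : q ≤ p) {d : ℕ} (P : Finset (Fin d → ℝ))
    (t : Fin d → ℝ)
    (ht : ∀ i : Fin d,
      (P.filter fun x => x i < t i).card = (P.filter fun x => t i < x i).card) :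
    ∑ x ∈ P, ∑ y ∈ P,
      lpNorm q (rescaledMazurMap p q (x - t) - rescaledMazurMap p q (y - t)) ^ q ≥
    (8 : ℝ) ^ (-q) * ∑ x ∈ P, ∑ y ∈ P, lpNorm p (x - y) ^ q := by
  have hp : 1 ≤ p := by linarith
  set g : (Fin d → ℝ) → Fin d → ℝ := fun x => rescaledMazurMap p q (x - t) with hg
  have hpos : ∀ x i, 0 < g x i ↔ t i < x i := by
    intro x i
    rcases lt_trichotomy (x i) (t i) with h | h | h
    · have := rescaled_neg (q := q) hp (x - t) i (by simpa using h)
      exact ⟨fun h' => absurd h' this.not_gt, fun h' => absurd h' h.not_gt⟩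
    · have := rescaled_zero p q (x - t) i (by simp [h])
      exact ⟨fun h' => absurd h' this.not_gt, fun h' => absurd h' h.not_gt⟩
    · exact ⟨fun _ => h, fun _ => rescaled_pos (q := q) hp (x - t) i (by simpa using h)⟩
  have hneg : ∀ x i, g x i < 0 ↔ x i < t i := by
    intro x i
    rcases lt_trichotomy (x i) (t i) with h | h | h
    · exact ⟨fun _ => h, fun _ => rescaled_neg (q := q) hp (x - t) i (by simpa using h)⟩
    · have := rescaled_zero p q (x - t) i (by simp [h])
      exact ⟨fun h' => absurd h' this.not_lt, fun h' => absurd h' h.not_lt⟩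
    · have := rescaled_pos (q := q) hp (x - t) i (by simpa using h)
      exact ⟨fun h' => absurd h' this.not_gt, fun h' => absurd h' h.not_gt⟩
  have hx : ∀ x, (P.card : ℝ) / 2 * lpNorm p (x - t) ^ q ≤
      ∑ y ∈ P, lpNorm q (g x - g y) ^ q := by
    intro x
    have e : lpNorm p (x - t) = lpNorm q (g x) := (lpNorm_rescaled hq hpq (x - t)).symm
    rw [e]
    simp_rw [lpNorm_rpow hq]
    rw [Finset.sum_comm, Finset.mul_sum]
    apply Finset.sum_le_sum
    intro i _
    have := median_sum P (fun x => g x i) (by simpa only [hpos, hneg] using ht i) hq x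
    simpa using this
  set S := ∑ x ∈ P, lpNorm p (x - t) ^ q with hS
  have hS0 : 0 ≤ S := Finset.sum_nonneg fun x _ => Real.rpow_nonneg (lpNorm_nonneg' _ _) _
  have hL : (P.card : ℝ) / 2 * S ≤ ∑ x ∈ P, ∑ y ∈ P, lpNorm q (g x - g y) ^ q := by
    rw [hS, Finset.mul_sum]
    exact Finset.sum_le_sum fun x _ => hx x
  have hR : ∑ x ∈ P, ∑ y ∈ P, lpNorm p (x - y) ^ q ≤ 2 ^ q * (2 * (P.card * S)) := by
    calc ∑ x ∈ P, ∑ y ∈ P, lpNorm p (x - y) ^ q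
        ≤ ∑ x ∈ P, ∑ y ∈ P, 2 ^ q * (lpNorm p (x - t) ^ q + lpNorm p (y - t) ^ q) := by
          apply Finset.sum_le_sum
          intro x _
          apply Finset.sum_le_sum
          intro y _
          refine le_trans ?_ (add_rpow_le_aux hq (lpNorm_nonneg' _ _) (lpNorm_nonneg' _ _))
          apply Real.rpow_le_rpow (lpNorm_nonneg' _ _) _ (by linarith)
          have := lpNorm_add_le' hp (x - t) (t - y)
          rwa [sub_add_sub_cancel, lpNorm_sub_comm' p t y] at this
      _ = 2 ^ q * (2 * (P.card * S)) := by
          simp_rw [← Finset.mul_sum, Finset.sum_add_distrib, Finset.sum_const, nsmul_eq_mul,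
            ← Finset.mul_sum]
          rw [← hS]
          ring
  have h8 : (8 : ℝ) ^ (-q) * 2 ^ q ≤ 1 / 4 := by
    have e : (8 : ℝ) ^ q = 4 ^ q * 2 ^ q := by
      rw [← Real.mul_rpow (by norm_num) (by norm_num)]; norm_num
    have h4 : (4 : ℝ) ≤ 4 ^ q := by
      have := Real.rpow_le_rpow_of_exponent_le (x := 4) (by norm_num) hq
      rwa [Real.rpow_one] at this
    have h2 : (0 : ℝ) < 2 ^ q := by positivity
    rw [Real.rpow_neg (by norm_num), e, mul_inv, mul_assoc, inv_mul_cancel₀ h2.ne', mul_one,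
      one_div]
    exact inv_anti₀ (by norm_num) h4
  have hcS : 0 ≤ (P.card : ℝ) * S := by positivity
  have hfin : (8 : ℝ) ^ (-q) * ∑ x ∈ P, ∑ y ∈ P, lpNorm p (x - y) ^ q ≤
      (P.card : ℝ) / 2 * S := by
    calc _ ≤ (8 : ℝ) ^ (-q) * (2 ^ q * (2 * (P.card * S))) :=
          mul_le_mul_of_nonneg_left hR (by positivity)
      _ = ((8 : ℝ) ^ (-q) * 2 ^ q) * (2 * (P.card * S)) := by ring
      _ ≤ 1 / 4 * (2 * (P.card * S)) := mul_le_mul_of_nonneg_right h8 (by linarith)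
      _ = _ := by ring
  exact hfin.trans hL

/-- Theorem (explicit average distortion embedding of ℓ_p^d into ℓ_q^d):
if `t` is a coordinatewise median of the finite point set `P`, then
`g(x) = M̃_{p,q}(x - t)` is `O(p/q)`-Lipschitz from ℓ_p^d to ℓ_q^d and has
`q`-average distortion `O(p/q)` with respect to `P`. -/
theorem stmt0 :
    ∃ C : ℝ, 1 ≤ C ∧
      ∀ (p q : ℝ), 1 ≤ q → q ≤ p →
      ∀ (d : ℕ), 1 ≤ d →
      ∀ (P : Finset (Fin d → ℝ)) (t : Fin d → ℝ),
        (∀ i : Fin d,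
          (P.filter fun x => x i < t i).card = (P.filter fun x => t i < x i).card) →
        (∀ x y : Fin d → ℝ,
            lpNorm q (rescaledMazurMap p q (x - t) - rescaledMazurMap p q (y - t)) ≤
              C * (p / q) * lpNorm p (x - y)) ∧
        (∑ x ∈ P, ∑ y ∈ P,
            lpNorm q (rescaledMazurMap p q (x - t) - rescaledMazurMap p q (y - t)) ^ q ≥
          C ^ (-q) * ∑ x ∈ P, ∑ y ∈ P, lpNorm p (x - y) ^ q) := by
  refine ⟨8, by norm_num, fun p q hq hpq d _ P t ht => ⟨fun x y => ?_, average hq hpq P t ht⟩⟩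
  have h := lipschitz hq hpq (x - t) (y - t)
  rw [sub_sub_sub_cancel_right] at h
  refine h.trans (mul_le_mul_of_nonneg_right ?_ (lpNorm_nonneg' _ _))
  have : 0 ≤ p / q := div_nonneg (by linarith) (by linarith)
  linarith
end

section
/- Let p ≥ q ≥ 1 be reals, let P ⊆ ℝ^d be a finite set of n points, and let t ∈ ℝ^d satisfy, for every coordinate i ∈ {1,...,d}, |{x ∈ P : x_i < t_i}| = |{x ∈ P : x_i > t_i}|. Then: (a) 0 is a median of the points M̃_{p,1}(x − t), x ∈ P, in ℓ_1^d, i.e., for every z ∈ ℝ^d, Σ_{x∈P} ‖M̃_{p,1}(x − t)‖_1 ≤ Σ_{x∈P} ‖M̃_{p,1}(x − t) − z‖_1; and (b) for every z ∈ ℝ^d, Σ_{x∈P} ‖M̃_{p,q}(x − t)‖_q^q ≤ 2^{q+1} · Σ_{x∈P} ‖M̃_{p,q}(x − t) − z‖_q^q (i.e., 0 is a (2^{1+1/q}, 0)-approximate q-mean of {M̃_{p,q}(x − t) : x ∈ P} in ℓ_q^d). -/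
open Finset
open scoped Classical

lemma lpNorm_pow (q : ℝ) (hq : 1 ≤ q) {d : ℕ} (y : Fin d → ℝ) :
    lpNorm q y ^ q = ∑ i, |y i| ^ q := by
  unfold lpNorm
  rw [← Real.rpow_mul (Finset.sum_nonneg fun i _ => Real.rpow_nonneg (abs_nonneg _) _)]
  rw [one_div, inv_mul_cancel₀ (by linarith), Real.rpow_one]

lemma lpNorm_one' {d : ℕ} (y : Fin d → ℝ) : lpNorm 1 y = ∑ i, |y i| := by
  simp [lpNorm]

/-- `s` is the sign of `y`. -/
def SignOf (s y : ℝ) : Prop := (s = 1 ∧ 0 < y) ∨ (s = -1 ∧ y < 0) ∨ (s = 0 ∧ y = 0)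

lemma signOf_rescaled (p q : ℝ) (hq : 1 ≤ q) (hpq : q ≤ p) {d : ℕ} (x : Fin d → ℝ) (i : Fin d) :
    SignOf (Real.sign (x i)) (rescaledMazurMap p q x i) := by
  unfold rescaledMazurMap
  split_ifs with h
  · right; right; simp [h]
  · have hne : ∃ j, x j ≠ 0 := by
      by_contra hc
      push Not at hc
      exact h (funext hc)
    obtain ⟨j, hj⟩ := hne
    have hpos : 0 < lpNorm p x := by
      unfold lpNorm
      apply Real.rpow_pos_of_pos
      exact Finset.sum_pos' (fun i _ => Real.rpow_nonneg (abs_nonneg _) _)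
        ⟨j, Finset.mem_univ _, Real.rpow_pos_of_pos (abs_pos.mpr hj) _⟩
    have hc : 0 < lpNorm p x ^ (1 - p / q) := Real.rpow_pos_of_pos hpos _
    simp only [Pi.smul_apply, smul_eq_mul, mazurMap]
    rcases lt_trichotomy (x i) 0 with hx | hx | hx
    · right; left
      have := Real.rpow_pos_of_pos (abs_pos.mpr hx.ne) (p / q)
      rw [Real.sign_of_neg hx]
      refine ⟨rfl, ?_⟩
      have := mul_pos hc this
      linarith
    · right; right
      simp [hx]
    · left
      have := Real.rpow_pos_of_pos (abs_pos.mpr hx.ne') (p / q)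
      rw [Real.sign_of_pos hx]
      refine ⟨rfl, ?_⟩
      have := mul_pos hc this
      linarith

lemma sum_sign_zero {α : Type*} (P : Finset α) (f : α → ℝ) 
    (h : (P.filter fun x => f x < 0).card = (P.filter fun x => 0 < f x).card) :
    ∑ x ∈ P, Real.sign (f x) = 0 := by
  have h1 : ∀ x ∈ P, Real.sign (f x) =
      (if 0 < f x then (1 : ℝ) else 0) - (if f x < 0 then (1 : ℝ) else 0) := by
    intro x _
    rcases lt_trichotomy (f x) 0 with hx | hx | hx
    · simp [Real.sign_of_neg hx, hx, hx.not_gt]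
    · simp [hx]
    · simp [Real.sign_of_pos hx, hx, hx.not_gt]
  rw [Finset.sum_congr rfl h1, Finset.sum_sub_distrib, Finset.sum_boole, Finset.sum_boole, h,
    sub_self]

lemma point_one (s y z : ℝ) (h : SignOf s y) : |y| ≤ |y - z| + s * z := by
  rcases h with ⟨rfl, h⟩ | ⟨rfl, h⟩ | ⟨rfl, h⟩
  · rw [abs_of_pos h]; linarith [le_abs_self (y - z)]
  · rw [abs_of_neg h]; linarith [neg_abs_le (y - z)]
  · simp [h]

lemma pow_same (q : ℝ) (hq : 1 ≤ q) (y z : ℝ) :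
    |y| ^ q ≤ 2 ^ q * |y - z| ^ q + 2 ^ (q - 1) * |z| ^ q := by
  have h1 : |y| ^ q ≤ (|y - z| + |z|) ^ q := by
    apply Real.rpow_le_rpow (abs_nonneg _) _ (by linarith)
    have := abs_add_le (y - z) z
    simpa using this
  have h2 : (|y - z| + |z|) ^ q ≤ 2 ^ (q - 1) * (|y - z| ^ q + |z| ^ q) := by
    have := NNReal.rpow_add_le_mul_rpow_add_rpow ⟨|y - z|, abs_nonneg _⟩ ⟨|z|, abs_nonneg _⟩ hq
    exact_mod_cast this
  have h3 : (2 : ℝ) ^ (q - 1) ≤ 2 ^ q := Real.rpow_le_rpow_of_exponent_le (by norm_num) (by linarith)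
  have h4 : 0 ≤ |y - z| ^ q := Real.rpow_nonneg (abs_nonneg _) _
  nlinarith [mul_le_mul_of_nonneg_right h3 h4]

lemma pow_opp (q : ℝ) (hq : 1 ≤ q) (y z : ℝ) (hy : |y| ≤ |y - z|) (hz : |z| ≤ |y - z|) :
    |y| ^ q + 2 ^ (q - 1) * |z| ^ q ≤ 2 ^ q * |y - z| ^ q := by
  have h1 : |y| ^ q ≤ |y - z| ^ q := Real.rpow_le_rpow (abs_nonneg _) hy (by linarith)
  have h2 : |z| ^ q ≤ |y - z| ^ q := Real.rpow_le_rpow (abs_nonneg _) hz (by linarith)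
  have h3 : (2 : ℝ) ^ q = 2 ^ (q - 1) * 2 := by
    rw [Real.rpow_sub_one (by norm_num)]; ring
  have h4 : (1 : ℝ) ≤ 2 ^ (q - 1) := Real.one_le_rpow (by norm_num) (by linarith)
  have h5 : 0 ≤ |y - z| ^ q := Real.rpow_nonneg (abs_nonneg _) _
  rw [h3]
  nlinarith [mul_le_mul_of_nonneg_left h2 (by linarith : (0 : ℝ) ≤ 2 ^ (q - 1)),
    mul_le_mul_of_nonneg_right h4 h5]

lemma point_q (q : ℝ) (hq : 1 ≤ q) (s y z : ℝ) (h : SignOf s y) :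
    |y| ^ q ≤ 2 ^ q * |y - z| ^ q + s * ((if 0 ≤ z then 1 else -1) * (2 ^ (q - 1) * |z| ^ q)) := by
  have hs := pow_same q hq y z
  rcases h with ⟨rfl, h⟩ | ⟨rfl, h⟩ | ⟨rfl, h⟩
  · split_ifs with hz
    · linarith
    · push Not at hz
      have := pow_opp q hq y z
        (by rw [abs_of_pos h, abs_of_pos (by linarith : 0 < y - z)]; linarith)
        (by rw [abs_of_neg hz, abs_of_pos (by linarith : 0 < y - z)]; linarith)
      linarith
  · split_ifs with hz
    · have := pow_opp q hq y z
        (by rw [abs_of_neg h, abs_of_neg (by linarith : y - z < 0)]; linarith)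
        (by rw [abs_of_nonneg hz, abs_of_neg (by linarith : y - z < 0)]; linarith)
      linarith
    · linarith
  · subst h
    rw [abs_zero, Real.zero_rpow (by linarith)]
    have : 0 ≤ |0 - z| ^ q := Real.rpow_nonneg (abs_nonneg _) _
    have : (0 : ℝ) < 2 ^ q := by positivity
    rw [zero_mul, add_zero]
    positivity

/-- If `t` is a coordinatewise median of `P`, then (a) `0` is a median of
`{M̃_{p,1}(x - t) : x ∈ P}` in ℓ_1^d, and (b) `0` is a `(2^{1+1/q}, 0)`-approximate
`q`-mean of `{M̃_{p,q}(x - t) : x ∈ P}` in ℓ_q^d. -/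
theorem stmt2 (p q : ℝ) (hq : 1 ≤ q) (hpq : q ≤ p) {d : ℕ}
    (P : Finset (Fin d → ℝ)) (t : Fin d → ℝ)
    (ht : ∀ i : Fin d,
      (P.filter fun x => x i < t i).card = (P.filter fun x => t i < x i).card) :
    (∀ z : Fin d → ℝ,
        ∑ x ∈ P, lpNorm 1 (rescaledMazurMap p 1 (x - t)) ≤
          ∑ x ∈ P, lpNorm 1 (rescaledMazurMap p 1 (x - t) - z)) ∧
    (∀ z : Fin d → ℝ,
        ∑ x ∈ P, lpNorm q (rescaledMazurMap p q (x - t)) ^ q ≤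
          (2 : ℝ) ^ (q + 1) * ∑ x ∈ P, lpNorm q (rescaledMazurMap p q (x - t) - z) ^ q) := by
  have hs : ∀ i, ∑ x ∈ P, Real.sign ((x - t) i) = 0 := by
    intro i
    apply sum_sign_zero P (fun x => (x - t) i)
    simpa only [Pi.sub_apply, sub_neg, sub_pos] using ht i
  constructor
  · intro z
    simp only [lpNorm_one']
    rw [Finset.sum_comm, Finset.sum_comm (s := P)]
    apply Finset.sum_le_sum
    intro i _
    calc ∑ x ∈ P, |rescaledMazurMap p 1 (x - t) i|
        ≤ ∑ x ∈ P, (|rescaledMazurMap p 1 (x - t) i - z i| + Real.sign ((x - t) i) * z i) :=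
          Finset.sum_le_sum fun x _ => point_one _ _ _
            (signOf_rescaled p 1 le_rfl (hq.trans hpq) (x - t) i)
      _ = _ := by
          rw [Finset.sum_add_distrib, ← Finset.sum_mul, hs i, zero_mul, add_zero]
          rfl
  · intro z
    simp only [lpNorm_pow q hq]
    have hmain : ∑ x ∈ P, ∑ i, |rescaledMazurMap p q (x - t) i| ^ q ≤
        2 ^ q * ∑ x ∈ P, ∑ i, |(rescaledMazurMap p q (x - t) - z) i| ^ q := by
      rw [Finset.sum_comm, Finset.sum_comm (s := P), Finset.mul_sum]
      apply Finset.sum_le_sum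
      intro i _
      refine (Finset.sum_le_sum fun x _ => point_q q hq _ _ (z i)
        (signOf_rescaled p q hq hpq (x - t) i)).trans (le_of_eq ?_)
      rw [Finset.sum_add_distrib, ← Finset.sum_mul, hs i, zero_mul, add_zero, Finset.mul_sum]
      rfl
    refine hmain.trans (mul_le_mul_of_nonneg_right
      (Real.rpow_le_rpow_of_exponent_le (by norm_num) (by linarith)) ?_)
    exact Finset.sum_nonneg fun x _ => Finset.sum_nonneg fun i _ =>
      Real.rpow_nonneg (abs_nonneg _) _
end

section
/- Let (M, dist) be a metric space and let P be a set of n points in M containing at least two distinct points. Let Δ = max_{x,y∈P} dist(x,y) and R = (1/n²) Σ_{x∈P} Σ_{y∈P} dist(x,y), so that 0 < R ≤ Δ. Then sup_{t ≥ 0} t·Ψ_M(P, t) ≤ R ≤ 2·ln(2Δ/R) · sup_{t ≥ 0} t·Ψ_M(P, t). -/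
open Finset
open scoped Classical

/-- `Ψ_M(P, t) = |{(x,y) ∈ P×P : dist(x,y) > t}| / n²` where `n = |P|`. -/
noncomputable def Psi {M : Type*} [MetricSpace M] (P : Finset M) (t : ℝ) : ℝ :=
  (((P ×ˢ P).filter fun z => t < dist z.1 z.2).card : ℝ) / (P.card : ℝ) ^ 2

open MeasureTheory in
lemma layer_bound (a d D : ℝ) (had : a ≤ D) (hd : d ≤ D) :
    d - a ≤ ∫ t in Set.Ioc a D, (Set.Iio d).indicator (fun _ => (1 : ℝ)) t := by
  rw [integral_indicator measurableSet_Iio, Measure.restrict_restrict measurableSet_Iio]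
  simp only [integral_const, smul_eq_mul, mul_one]
  rw [measureReal_restrict_apply_univ]
  have h : volume.real (Set.Ioo a d) ≤ volume.real (Set.Iio d ∩ Set.Ioc a D) := by
    apply measureReal_mono
    · intro x hx
      exact ⟨hx.2, hx.1, hx.2.le.trans hd⟩
    · exact ne_top_of_le_ne_top (by simp) (measure_mono (Set.inter_subset_right))
  rw [Real.volume_real_Ioo] at h
  exact (le_max_left _ _).trans h

open MeasureTheory in
lemma sum_bound {ι : Type*} (Z : Finset ι) (f : ι → ℝ) (a D C : ℝ) (ha : 0 < a) (haD : a ≤ D)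
    (hf : ∀ z ∈ Z, f z ≤ D)
    (hC : ∀ t, 0 < t → t * ((Z.filter fun z => t < f z).card : ℝ) ≤ C) :
    ∑ z ∈ Z, f z ≤ Z.card * a + C * Real.log (D / a) := by
  have hInt : ∀ z ∈ Z, Integrable ((Set.Iio (f z)).indicator (fun _ => (1 : ℝ)))
      (volume.restrict (Set.Ioc a D)) := fun z _ =>
    (integrable_const (1 : ℝ)).indicator measurableSet_Iio
  have h1 : ∑ z ∈ Z, (f z - a) ≤
      ∫ t in Set.Ioc a D, ∑ z ∈ Z, (Set.Iio (f z)).indicator (fun _ => (1 : ℝ)) t := by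
    rw [integral_finsetSum _ hInt]
    exact Finset.sum_le_sum fun z hz => layer_bound a (f z) D haD (hf z hz)
  have h0 : (0 : ℝ) ∉ Set.uIcc a D := by
    rw [Set.uIcc_of_le haD]
    intro h
    exact absurd h.1 (not_le.mpr ha)
  have hi : IntervalIntegrable (fun t : ℝ => C * t⁻¹) volume a D :=
    (intervalIntegrable_inv_iff.2 (Or.inr h0)).const_mul C
  have h2 : ∫ t in Set.Ioc a D, ∑ z ∈ Z, (Set.Iio (f z)).indicator (fun _ => (1 : ℝ)) t
      ≤ ∫ t in Set.Ioc a D, C * t⁻¹ := by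
    apply setIntegral_mono_on (integrable_finsetSum _ hInt) ?_ measurableSet_Ioc
    · intro t ht
      have ht0 : 0 < t := ha.trans ht.1
      have := hC t ht0
      have e : ∑ z ∈ Z, (Set.Iio (f z)).indicator (fun _ => (1 : ℝ)) t
          = ((Z.filter fun z => t < f z).card : ℝ) := by
        simp [Set.indicator_apply, Finset.sum_ite]
      rw [e, ← div_eq_mul_inv, le_div_iff₀ ht0]
      linarith
    · exact (intervalIntegrable_iff_integrableOn_Ioc_of_le haD).1 hi
  rw [← intervalIntegral.integral_of_le (f := fun t : ℝ => C * t⁻¹) haD,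
    intervalIntegral.integral_const_mul, integral_inv h0] at h2
  rw [Finset.sum_sub_distrib, Finset.sum_const, nsmul_eq_mul] at h1
  linarith

/-- Comparison between the weak-L₁ norm `sup_{t≥0} t·Ψ_M(P,t)` of the distance
function and its average `R`: `sup_{t≥0} t·Ψ_M(P,t) ≤ R ≤ 2 ln(2Δ/R) · sup_{t≥0} t·Ψ_M(P,t)`,
where `Δ` is the diameter of `P` and `P` contains two distinct points (so `0 < R ≤ Δ`). -/
theorem stmt6 {M : Type*} [MetricSpace M] (P : Finset M)
    (hP : ∃ x ∈ P, ∃ y ∈ P, x ≠ y) (Δ R : ℝ)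
    (hΔ : IsGreatest {s : ℝ | ∃ x ∈ P, ∃ y ∈ P, s = dist x y} Δ)
    (hR : R = (∑ x ∈ P, ∑ y ∈ P, dist x y) / (P.card : ℝ) ^ 2) :
    0 < R ∧ R ≤ Δ ∧
    sSup {s : ℝ | ∃ t : ℝ, 0 ≤ t ∧ s = t * Psi P t} ≤ R ∧
    R ≤ 2 * Real.log (2 * Δ / R) *
        sSup {s : ℝ | ∃ t : ℝ, 0 ≤ t ∧ s = t * Psi P t} := by
  obtain ⟨x0, hx0, y0, hy0, hne⟩ := hP
  have hn : (0 : ℝ) < (P.card : ℝ) ^ 2 := by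
    have : 0 < P.card := Finset.card_pos.2 ⟨x0, hx0⟩
    positivity
  rw [← Finset.sum_product' P P (fun x y => dist x y)] at hR
  have hZ : (((P ×ˢ P).card : ℕ) : ℝ) = (P.card : ℝ) ^ 2 := by
    rw [Finset.card_product]; push_cast; ring
  have hle : ∀ z ∈ P ×ˢ P, dist z.1 z.2 ≤ Δ := by
    intro z hz
    rw [Finset.mem_product] at hz
    exact hΔ.2 ⟨z.1, hz.1, z.2, hz.2, rfl⟩
  have hRn : ∑ z ∈ P ×ˢ P, dist z.1 z.2 = R * (P.card : ℝ) ^ 2 := by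
    rw [hR, div_mul_cancel₀ _ hn.ne']
  have hRpos : 0 < R := by
    rw [hR]
    apply div_pos _ hn
    exact Finset.sum_pos' (fun _ _ => dist_nonneg)
      ⟨(x0, y0), Finset.mk_mem_product hx0 hy0, dist_pos.2 hne⟩
  have hRΔ : R ≤ Δ := by
    rw [hR, div_le_iff₀ hn]
    refine (Finset.sum_le_card_nsmul _ _ _ hle).trans (le_of_eq ?_)
    rw [nsmul_eq_mul, hZ, mul_comm]
  have hub : ∀ s ∈ {s : ℝ | ∃ t : ℝ, 0 ≤ t ∧ s = t * Psi P t}, s ≤ R := by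
    rintro s ⟨t, ht, rfl⟩
    rw [hR, Psi, ← mul_div_assoc]
    refine div_le_div_of_nonneg_right ?_ hn.le
    calc _ = ((P ×ˢ P).filter fun z => t < dist z.1 z.2).card • t := by
          rw [nsmul_eq_mul, mul_comm]
      _ ≤ ∑ z ∈ (P ×ˢ P).filter fun z => t < dist z.1 z.2, dist z.1 z.2 :=
          Finset.card_nsmul_le_sum _ _ _ fun z hz => (Finset.mem_filter.1 hz).2.le
      _ ≤ _ := Finset.sum_le_sum_of_subset_of_nonneg (Finset.filter_subset _ _)
          fun _ _ _ => dist_nonneg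
  refine ⟨hRpos, hRΔ, csSup_le ⟨_, 0, le_rfl, rfl⟩ hub, ?_⟩
  set S := sSup {s : ℝ | ∃ t : ℝ, 0 ≤ t ∧ s = t * Psi P t} with hS
  have key := sum_bound (P ×ˢ P) (fun z => dist z.1 z.2) (R / 2) Δ (S * (P.card : ℝ) ^ 2)
    (by positivity) (by linarith) hle (by
      intro t ht
      have : t * Psi P t ≤ S := le_csSup ⟨R, hub⟩ ⟨t, ht.le, rfl⟩
      rw [Psi, ← mul_div_assoc, div_le_iff₀ hn] at this
      exact this)
  rw [hRn, hZ, show Δ / (R / 2) = 2 * Δ / R by field_simp] at key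
  have : R * (P.card : ℝ) ^ 2 ≤ (R / 2 + S * Real.log (2 * Δ / R)) * (P.card : ℝ) ^ 2 := by
    linarith
  have := le_of_mul_le_mul_right this hn
  linarith
end

section
/- Let (M, dist_M) and (N, dist_N) be metric spaces, let P ⊆ M be a set of n ≥ 2 points with Σ_{x∈P} Σ_{y∈P} dist_M(x,y) > 0, and let f : M → N be Lipschitz with Lipschitz constant L ∈ (0,∞). Let D ≥ 1 and C ≥ 1. Suppose that Σ_{x∈P} Σ_{y∈P} dist_N(f(x), f(y)) ≥ (L/D) · Σ_{x∈P} Σ_{y∈P} dist_M(x,y) (i.e., f has average distortion at most D with respect to P), and that the diameter of f(P) in N is at most (C/n²) · Σ_{x∈P} Σ_{y∈P} dist_M(x,y). Then sup_{t ≥ 0} t·Ψ_N(f(P), t) ≥ (L / (2D·ln(2CD/L))) · sup_{t ≥ 0} t·Ψ_M(P, t); that is, f has weak average distortion at most 2D·ln(2CD/L) with respect to P. -/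
open Finset
open scoped Classical

/-- `Ψ_N(f(P), t) = |{(x,y) ∈ P×P : dist(f x, f y) > t}| / n²`. -/
noncomputable def PsiMap {M N : Type*} [MetricSpace M] [MetricSpace N]
    (f : M → N) (P : Finset M) (t : ℝ) : ℝ :=
  (((P ×ˢ P).filter fun z => t < dist (f z.1) (f z.2)).card : ℝ) / (P.card : ℝ) ^ 2


lemma aux_markov {ι : Type*} (Q : Finset ι) (g : ι → ℝ) (hg : ∀ z ∈ Q, 0 ≤ g z) (t : ℝ) :
    t * ((Q.filter fun z => t < g z).card : ℝ) ≤ ∑ z ∈ Q, g z := by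
  calc t * ((Q.filter fun z => t < g z).card : ℝ) = ∑ z ∈ Q.filter (fun z => t < g z), t := by
        rw [Finset.sum_const, nsmul_eq_mul, mul_comm]
    _ ≤ ∑ z ∈ Q.filter (fun z => t < g z), g z :=
        Finset.sum_le_sum fun z hz => (Finset.mem_filter.1 hz).2.le
    _ ≤ ∑ z ∈ Q, g z :=
        Finset.sum_le_sum_of_subset_of_nonneg (Finset.filter_subset _ _) fun z hz _ => hg z hz

lemma aux_anti (d : ℝ) : Antitone (fun t : ℝ => if t < d then (1 : ℝ) else 0) := by
  intro x y hxy
  dsimp only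
  by_cases h1 : y < d
  · rw [if_pos h1, if_pos (lt_of_le_of_lt hxy h1)]
  · rw [if_neg h1]
    split_ifs <;> norm_num

lemma aux_intable (d a b : ℝ) :
    IntervalIntegrable (fun t : ℝ => if t < d then (1 : ℝ) else 0) MeasureTheory.volume a b :=
  (aux_anti d).intervalIntegrable

lemma aux_int (d δ K : ℝ) (hdK : d ≤ K) (hδK : δ ≤ K) :
    d ≤ δ + ∫ t in δ..K, (if t < d then (1 : ℝ) else 0) := by
  have hnn : ∀ t : ℝ, 0 ≤ (if t < d then (1 : ℝ) else 0) := by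
    intro t; split_ifs <;> norm_num
  by_cases h : d ≤ δ
  · have := intervalIntegral.integral_nonneg (μ := MeasureTheory.volume) hδK (fun t _ => hnn t)
    linarith
  · push Not at h
    rw [← intervalIntegral.integral_add_adjacent_intervals (aux_intable d δ d) (aux_intable d d K)]
    have h2 := intervalIntegral.integral_nonneg (μ := MeasureTheory.volume) hdK (fun t _ => hnn t)
    have h1 : ∫ t in δ..d, (1 : ℝ) ≤ ∫ t in δ..d, (if t < d then (1 : ℝ) else 0) := by
      apply intervalIntegral.integral_mono_on_of_le_Ioo h.le
        intervalIntegrable_const (aux_intable d δ d)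
      intro t ht
      rw [if_pos ht.2]
    simp only [intervalIntegral.integral_const, smul_eq_mul, mul_one] at h1
    linarith

lemma aux_core {ι : Type*} (Q : Finset ι) (g : ι → ℝ) (K δ W : ℝ) (hgK : ∀ z ∈ Q, g z ≤ K)
    (hδ : 0 < δ) (hδK : δ ≤ K)
    (hW : ∀ t : ℝ, 0 ≤ t → t * ((Q.filter fun z => t < g z).card : ℝ) ≤ W) :
    ∑ z ∈ Q, g z ≤ (Q.card : ℝ) * δ + W * Real.log (K / δ) := by
  have h1 : ∑ z ∈ Q, g z ≤ ∑ z ∈ Q, (δ + ∫ t in δ..K, (if t < g z then (1 : ℝ) else 0)) :=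
    Finset.sum_le_sum fun z hz => aux_int _ _ _ (hgK z hz) hδK
  rw [Finset.sum_add_distrib, Finset.sum_const, nsmul_eq_mul,
    ← intervalIntegral.integral_finsetSum (fun z _ => aux_intable (g z) δ K)] at h1
  have h0 : (0 : ℝ) ∉ Set.uIcc δ K := by
    rw [Set.uIcc_of_le hδK]
    intro h
    linarith [h.1]
  have h2 : ∫ t in δ..K, ∑ z ∈ Q, (if t < g z then (1 : ℝ) else 0) ≤ ∫ t in δ..K, W * t⁻¹ := by
    apply intervalIntegral.integral_mono_on hδK
    · apply Antitone.intervalIntegrable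
      intro x y hxy
      exact Finset.sum_le_sum fun z _ => aux_anti (g z) hxy
    · apply IntervalIntegrable.const_mul
      apply intervalIntegral.intervalIntegrable_inv
      · intro x hx h
        exact h0 (h ▸ hx)
      · exact continuousOn_id
    · intro t ht
      have htp : 0 < t := lt_of_lt_of_le hδ ht.1
      have := hW t htp.le
      rw [Finset.sum_boole, ← div_eq_mul_inv, le_div_iff₀ htp]
      linarith
  rw [intervalIntegral.integral_const_mul, integral_inv h0] at h2
  linarith

/-- If `f` has average distortion at most `D` with respect to `P`, and the diameter of
`f(P)` is at most `C/n²` times the sum of pairwise distances in `P`, then `f` has weak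
average distortion at most `2D·ln(2CD/L)` with respect to `P`. -/
theorem stmt8 {M N : Type*} [MetricSpace M] [MetricSpace N]
    (P : Finset M) (hn : 2 ≤ P.card)
    (f : M → N) (L D C : ℝ) (hL0 : 0 < L) (hD : 1 ≤ D) (hC : 1 ≤ C)
    (hpos : 0 < ∑ x ∈ P, ∑ y ∈ P, dist x y)
    (hlip : ∀ x y : M, dist (f x) (f y) ≤ L * dist x y)
    (havg : ∑ x ∈ P, ∑ y ∈ P, dist (f x) (f y) ≥
      (L / D) * ∑ x ∈ P, ∑ y ∈ P, dist x y)
    (hdiam : ∀ x ∈ P, ∀ y ∈ P,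
      dist (f x) (f y) ≤ (C / (P.card : ℝ) ^ 2) * ∑ a ∈ P, ∑ b ∈ P, dist a b) :
    sSup {v : ℝ | ∃ t : ℝ, 0 ≤ t ∧ v = t * PsiMap f P t} ≥
      (L / (2 * D * Real.log (2 * C * D / L))) *
        sSup {v : ℝ | ∃ t : ℝ, 0 ≤ t ∧ v = t * Psi P t} := by
  have hn0 : (0 : ℝ) < (P.card : ℝ) ^ 2 := by
    have : 0 < P.card := by omega
    positivity
  set n2 : ℝ := (P.card : ℝ) ^ 2 with hn2
  have hcard : ((P ×ˢ P).card : ℝ) = n2 := by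
    rw [Finset.card_product]; push_cast; rw [hn2]; ring
  set S : ℝ := ∑ x ∈ P, ∑ y ∈ P, dist x y with hS
  have hSp : ∑ z ∈ P ×ˢ P, dist z.1 z.2 = S := Finset.sum_product _ _ _
  have hTp : ∑ z ∈ P ×ˢ P, dist (f z.1) (f z.2) = ∑ x ∈ P, ∑ y ∈ P, dist (f x) (f y) :=
    Finset.sum_product _ _ _
  have hD0 : 0 < D := by linarith
  have hC0 : 0 < C := by linarith
  have hgK : ∀ z ∈ P ×ˢ P, dist (f z.1) (f z.2) ≤ C / n2 * S := fun z hz =>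
    hdiam _ (Finset.mem_product.1 hz).1 _ (Finset.mem_product.1 hz).2
  rw [← hTp] at havg
  -- `L ≤ C * D`
  have hLCD : L ≤ C * D := by
    have h1 := Finset.sum_le_sum hgK
    rw [Finset.sum_const, nsmul_eq_mul, hcard] at h1
    have h2 : n2 * (C / n2 * S) = C * S := by field_simp
    rw [h2] at h1
    have h3 : L / D * S ≤ C * S := le_trans havg h1
    have h4 := le_of_mul_le_mul_right h3 hpos
    rwa [div_le_iff₀ hD0] at h4
  have hlog : 0 < Real.log (2 * C * D / L) := by
    apply Real.log_pos
    rw [lt_div_iff₀ hL0]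
    linarith
  have hbdd : BddAbove {v : ℝ | ∃ t : ℝ, 0 ≤ t ∧ v = t * PsiMap f P t} := by
    refine ⟨(∑ z ∈ P ×ˢ P, dist (f z.1) (f z.2)) / n2, ?_⟩
    rintro v ⟨t, ht, rfl⟩
    unfold PsiMap
    rw [← mul_div_assoc]
    exact div_le_div_of_nonneg_right
      (aux_markov (P ×ˢ P) (fun z => dist (f z.1) (f z.2)) (fun _ _ => dist_nonneg) t) hn0.le
  set W := sSup {v : ℝ | ∃ t : ℝ, 0 ≤ t ∧ v = t * PsiMap f P t} with hWdef
  have hW : ∀ t : ℝ, 0 ≤ t →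
      t * (((P ×ˢ P).filter fun z => t < dist (f z.1) (f z.2)).card : ℝ) ≤ W * n2 := by
    intro t ht
    have h : t * PsiMap f P t ≤ W := le_csSup hbdd ⟨t, ht, rfl⟩
    unfold PsiMap at h
    rwa [← mul_div_assoc, div_le_iff₀ hn0] at h
  have hR : sSup {v : ℝ | ∃ t : ℝ, 0 ≤ t ∧ v = t * Psi P t} ≤ S / n2 := by
    refine csSup_le ⟨0 * Psi P 0, 0, le_rfl, rfl⟩ ?_
    rintro v ⟨t, ht, rfl⟩
    unfold Psi
    rw [← mul_div_assoc, ← hSp]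
    exact div_le_div_of_nonneg_right
      (aux_markov (P ×ˢ P) (fun z => dist z.1 z.2) (fun _ _ => dist_nonneg) t) hn0.le
  have hδ : 0 < L * S / (2 * D * n2) := by positivity
  have hδK : L * S / (2 * D * n2) ≤ C / n2 * S := by
    have : C / n2 * S = (2 * C * D) * S / (2 * D * n2) := by field_simp
    rw [this]
    apply div_le_div_of_nonneg_right _ (by positivity)
    apply mul_le_mul_of_nonneg_right _ hpos.le
    nlinarith
  have hcore := aux_core (P ×ˢ P) (fun z => dist (f z.1) (f z.2)) (C / n2 * S)
    (L * S / (2 * D * n2)) (W * n2) hgK hδ hδK hW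
  have hq : C / n2 * S / (L * S / (2 * D * n2)) = 2 * C * D / L := by field_simp
  rw [hq, hcard] at hcore
  set l := Real.log (2 * C * D / L) with hl
  have h5 : n2 * (L * S / (2 * D * n2)) = L / D * S / 2 := by field_simp
  rw [h5] at hcore
  have h6 : L / D * S / 2 ≤ W * n2 * l := by
    have := le_trans havg hcore
    linarith
  calc L / (2 * D * l) * sSup {v : ℝ | ∃ t : ℝ, 0 ≤ t ∧ v = t * Psi P t}
      ≤ L / (2 * D * l) * (S / n2) := mul_le_mul_of_nonneg_left hR (by positivity)
    _ = (L / D * S / 2) / (n2 * l) := by field_simp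
    _ ≤ W := by
      rw [div_le_iff₀ (by positivity)]
      linarith
end

section
/- Let q ≥ 1 and let P be a set of n ≥ 1 points in a metric space (M, dist). Then (1/(2^q n²)) · Σ_{x∈P} Σ_{y∈P} dist(x,y)^q ≤ inf_{z∈M} (1/n) Σ_{x∈P} dist(x,z)^q ≤ (1/n²) · Σ_{x∈P} Σ_{y∈P} dist(x,y)^q. Moreover, if M is a real normed space and z ∈ M satisfies ‖z − (1/n) Σ_{x∈P} x‖ ≤ ε, then (1/n) Σ_{x∈P} ‖x − z‖^q ≤ 2^{2q−1} · inf_{w∈M} (1/n) Σ_{x∈P} ‖x − w‖^q + 2^{q−1} ε^q; that is, z is a (2^{2−1/q}, 2^{1−1/q}·ε)-approximate q-mean of P. -/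
open Finset

universe u v

lemma add_rpow_aux (q : ℝ) (hq : 1 ≤ q) (a b : ℝ) (ha : 0 ≤ a) (hb : 0 ≤ b) :
    (a + b) ^ q ≤ (2 : ℝ) ^ (q - 1) * (a ^ q + b ^ q) := by
  have h := NNReal.rpow_add_le_mul_rpow_add_rpow ⟨a, ha⟩ ⟨b, hb⟩ hq
  exact_mod_cast h

lemma lower_aux (q : ℝ) (hq : 1 ≤ q) {M : Type u} [MetricSpace M] (P : Finset M) (z : M) :
    ∑ x ∈ P, ∑ y ∈ P, dist x y ^ q ≤
      (2 : ℝ) ^ q * ((P.card : ℝ) * ∑ x ∈ P, dist x z ^ q) := by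
  have h2 : (2 : ℝ) ^ q = 2 ^ (q - 1) * 2 := by
    rw [Real.rpow_sub_one (by norm_num)]; ring
  calc ∑ x ∈ P, ∑ y ∈ P, dist x y ^ q
      ≤ ∑ x ∈ P, ∑ y ∈ P, (2 : ℝ) ^ (q - 1) * (dist x z ^ q + dist y z ^ q) := by
        refine sum_le_sum fun x _ => sum_le_sum fun y _ => ?_
        refine le_trans ?_ (add_rpow_aux q hq _ _ dist_nonneg dist_nonneg)
        exact Real.rpow_le_rpow dist_nonneg (dist_triangle_right x y z) (by linarith)
    _ = _ := by
        simp only [← mul_sum, sum_add_distrib, sum_const, nsmul_eq_mul]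
        rw [h2]; ring

lemma jensen_aux (q : ℝ) (hq : 1 ≤ q) {V : Type v} [NormedAddCommGroup V] [NormedSpace ℝ V]
    (Q : Finset V) (hQ : Q.Nonempty) (x : V) :
    ‖x - (Q.card : ℝ)⁻¹ • ∑ y ∈ Q, y‖ ^ q ≤ (Q.card : ℝ)⁻¹ * ∑ y ∈ Q, dist x y ^ q := by
  have hn : (0 : ℝ) < Q.card := by exact_mod_cast hQ.card_pos
  have h1 : x - (Q.card : ℝ)⁻¹ • ∑ y ∈ Q, y = ∑ y ∈ Q, (Q.card : ℝ)⁻¹ • (x - y) := by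
    rw [← smul_sum, sum_sub_distrib, smul_sub, sum_const, ← Nat.cast_smul_eq_nsmul ℝ, smul_smul,
      inv_mul_cancel₀ hn.ne', one_smul]
  have h2 : ‖x - (Q.card : ℝ)⁻¹ • ∑ y ∈ Q, y‖ ≤ ∑ y ∈ Q, (Q.card : ℝ)⁻¹ * dist x y := by
    rw [h1]
    refine (norm_sum_le _ _).trans (le_of_eq ?_)
    refine sum_congr rfl fun y _ => ?_
    rw [norm_smul, dist_eq_norm, Real.norm_of_nonneg (by positivity)]
  refine (Real.rpow_le_rpow (norm_nonneg _) h2 (by linarith)).trans ?_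
  rw [mul_sum]
  refine Real.rpow_arith_mean_le_arith_mean_rpow Q (fun _ => (Q.card : ℝ)⁻¹) (fun y => dist x y)
    (fun _ _ => by positivity) ?_ (fun _ _ => dist_nonneg) hq
  rw [sum_const, nsmul_eq_mul, mul_inv_cancel₀ hn.ne']

/-- For `q ≥ 1`: (i) the optimal `q`-mean objective of an `n`-point set `P` in a metric
space is between `(1/2^q)` times and once the average `q`-th power of pairwise distances;
(ii) in a normed space, any point within `ε` of the mean of `P` is a
`(2^{2-1/q}, 2^{1-1/q}·ε)`-approximate `q`-mean of `P`. -/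
theorem stmt10 (q : ℝ) (hq : 1 ≤ q) :
    (∀ (M : Type u) [instM : MetricSpace M] (P : Finset M), P.Nonempty →
      (1 / ((2 : ℝ) ^ q * (P.card : ℝ) ^ 2)) * (∑ x ∈ P, ∑ y ∈ P, dist x y ^ q) ≤
        sInf {v : ℝ | ∃ z : M, v = (1 / (P.card : ℝ)) * ∑ x ∈ P, dist x z ^ q} ∧
      sInf {v : ℝ | ∃ z : M, v = (1 / (P.card : ℝ)) * ∑ x ∈ P, dist x z ^ q} ≤
        (1 / (P.card : ℝ) ^ 2) * (∑ x ∈ P, ∑ y ∈ P, dist x y ^ q)) ∧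
    (∀ (V : Type v) [instV : NormedAddCommGroup V] [instV' : NormedSpace ℝ V]
        (Q : Finset V), Q.Nonempty →
      ∀ (z : V) (ε : ℝ), 0 ≤ ε →
        ‖z - (Q.card : ℝ)⁻¹ • ∑ x ∈ Q, x‖ ≤ ε →
        (1 / (Q.card : ℝ)) * ∑ x ∈ Q, ‖x - z‖ ^ q ≤
          (2 : ℝ) ^ (2 * q - 1) *
              sInf {v : ℝ | ∃ w : V, v = (1 / (Q.card : ℝ)) * ∑ x ∈ Q, ‖x - w‖ ^ q} +
            (2 : ℝ) ^ (q - 1) * ε ^ q) := by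

  have h2q : (0 : ℝ) < 2 ^ q := by positivity
  refine ⟨?_, ?_⟩
  · intro M _ P hP
    have hn : (0 : ℝ) < P.card := by exact_mod_cast hP.card_pos
    constructor
    · refine le_csInf ⟨_, hP.choose, rfl⟩ ?_
      rintro _ ⟨z, rfl⟩
      have h := lower_aux q hq P z
      rw [one_div, inv_mul_le_iff₀ (by positivity)]
      refine h.trans (le_of_eq ?_)
      field_simp
    · set s := sInf {v : ℝ | ∃ z : M, v = (1 / (P.card : ℝ)) * ∑ x ∈ P, dist x z ^ q} with hs
      have hle : ∀ y ∈ P, s ≤ (1 / (P.card : ℝ)) * ∑ x ∈ P, dist x y ^ q := by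
        intro y _
        refine csInf_le ⟨0, ?_⟩ ⟨y, rfl⟩
        rintro _ ⟨z, rfl⟩
        positivity
      have h := sum_le_sum hle
      rw [sum_const, nsmul_eq_mul, ← mul_sum, sum_comm] at h
      have h3 : s = (1 / (P.card : ℝ)) * (P.card * s) := by field_simp
      rw [h3]
      refine (mul_le_mul_of_nonneg_left h (by positivity)).trans (le_of_eq ?_)
      field_simp
  · intro V _ _ Q hQ z ε hε hz
    have hn : (0 : ℝ) < Q.card := by exact_mod_cast hQ.card_pos
    set c := (Q.card : ℝ)⁻¹ • ∑ x ∈ Q, x with hc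
    set s := sInf {v : ℝ | ∃ w : V, v = (1 / (Q.card : ℝ)) * ∑ x ∈ Q, ‖x - w‖ ^ q} with hs
    set D := ∑ x ∈ Q, ∑ y ∈ Q, dist x y ^ q with hD
    have hlow : D / (2 ^ q * (Q.card : ℝ) ^ 2) ≤ s := by
      refine le_csInf ⟨_, 0, rfl⟩ ?_
      rintro _ ⟨w, rfl⟩
      have h := lower_aux q hq Q w
      rw [div_le_iff₀ (by positivity)]
      refine h.trans (le_of_eq ?_)
      simp only [dist_eq_norm]
      field_simp
    have hA : ∑ x ∈ Q, ‖x - c‖ ^ q ≤ (Q.card : ℝ)⁻¹ * D := by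
      rw [hD, mul_sum]
      exact sum_le_sum fun x _ => jensen_aux q hq Q hQ x
    have hB : ∑ x ∈ Q, ‖x - z‖ ^ q ≤
        2 ^ (q - 1) * (∑ x ∈ Q, ‖x - c‖ ^ q + Q.card * ε ^ q) := by
      calc ∑ x ∈ Q, ‖x - z‖ ^ q ≤ ∑ x ∈ Q, (2 : ℝ) ^ (q - 1) * (‖x - c‖ ^ q + ε ^ q) := by
            refine sum_le_sum fun x _ => ?_
            refine le_trans ?_ (add_rpow_aux q hq _ _ (norm_nonneg _) hε)
            refine Real.rpow_le_rpow (norm_nonneg _) ?_ (by linarith)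
            have h4 := norm_sub_le_norm_sub_add_norm_sub x c z
            rw [norm_sub_rev c z] at h4
            linarith
        _ = _ := by
            simp only [← mul_sum, sum_add_distrib, sum_const, nsmul_eq_mul]
    have h5 : (2 : ℝ) ^ (2 * q - 1) = 2 ^ (q - 1) * 2 ^ q := by
      rw [← Real.rpow_add (by norm_num)]; congr 1; ring
    have hC : (Q.card : ℝ)⁻¹ * ((Q.card : ℝ)⁻¹ * D) ≤ 2 ^ q * s := by
      have := mul_le_mul_of_nonneg_left hlow h2q.le
      refine le_trans (le_of_eq ?_) this
      field_simp
    calc (1 / (Q.card : ℝ)) * ∑ x ∈ Q, ‖x - z‖ ^ q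
        ≤ (1 / (Q.card : ℝ)) * (2 ^ (q - 1) * ((Q.card : ℝ)⁻¹ * D + Q.card * ε ^ q)) := by
          gcongr
          exact hB.trans (by gcongr)
      _ = 2 ^ (q - 1) * ((Q.card : ℝ)⁻¹ * ((Q.card : ℝ)⁻¹ * D)) + 2 ^ (q - 1) * ε ^ q := by
          field_simp
      _ ≤ 2 ^ (q - 1) * (2 ^ q * s) + 2 ^ (q - 1) * ε ^ q := by gcongr
      _ = _ := by rw [h5]; ring
end

section
/- Let U and V be real normed spaces, let ω ∈ (0,1], p ≥ ω, and C > 0, and let g : S_U → S_V be a map between the unit spheres satisfying ‖g(x) − g(y)‖_V ≤ C·‖x − y‖_U^ω for all x, y ∈ S_U. Let g̃ : U → V be the degree-p radial extension of g. Then for all x, y ∈ U, ‖g̃(x) − g̃(y)‖_V ≤ (p/ω + 2^ω·C) · ‖x − y‖_U^ω · max(‖x‖_U, ‖y‖_U)^{p−ω}. -/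
open scoped Classical

/-- The degree-`p` radial extension of a map `g` between unit spheres:
`g̃(x) = ‖x‖^p · g(x/‖x‖)` for `x ≠ 0`, and `g̃(0) = 0`. -/
noncomputable def radialExt {U V : Type*} [NormedAddCommGroup U] [NormedSpace ℝ U]
    [NormedAddCommGroup V] [NormedSpace ℝ V] (p : ℝ) (g : U → V) (x : U) : V :=
  if x = 0 then 0 else ‖x‖ ^ p • g (‖x‖⁻¹ • x)

lemma aux_scalar (ω p a b : ℝ) (hω0 : 0 < ω) (hω1 : ω ≤ 1) (hp : ω ≤ p)
    (hb : 0 < b) (hba : b ≤ a) :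
    a ^ p - b ^ p ≤ p / ω * (a - b) ^ ω * a ^ (p - ω) := by
  have ha : 0 < a := hb.trans_le hba
  have hq : 1 ≤ p / ω := (one_le_div hω0).2 hp
  have hA : 0 < a ^ ω := Real.rpow_pos_of_pos ha _
  have hB : 0 < b ^ ω := Real.rpow_pos_of_pos hb _
  have h1 : a ^ ω ≤ (a - b) ^ ω + b ^ ω := by
    have := Real.rpow_add_le_add_rpow (sub_nonneg.2 hba) hb.le hω0.le hω1
    simpa using this
  have h2 := one_add_mul_self_le_rpow_one_add (s := b ^ ω / a ^ ω - 1)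
    (by have := div_pos hB hA; linarith) hq
  have h3 : (1 + (b ^ ω / a ^ ω - 1)) ^ (p / ω) = b ^ p / a ^ p := by
    rw [add_sub_cancel, Real.div_rpow hB.le hA.le, ← Real.rpow_mul hb.le, ← Real.rpow_mul ha.le,
      mul_div_cancel₀ _ hω0.ne']
  rw [h3] at h2
  have hAp : 0 < a ^ p := Real.rpow_pos_of_pos ha _
  have h4 : a ^ (p - ω) = a ^ p / a ^ ω := Real.rpow_sub ha _ _
  have h5 : a ^ p * (1 + p / ω * (b ^ ω / a ^ ω - 1)) ≤ b ^ p := by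
    rw [le_div_iff₀ hAp] at h2
    linarith
  have h6 : a ^ p * (1 + p / ω * (b ^ ω / a ^ ω - 1))
      = a ^ p - p / ω * (a ^ ω - b ^ ω) * (a ^ p / a ^ ω) := by
    field_simp
    ring
  have h7 : p / ω * (a ^ ω - b ^ ω) * (a ^ p / a ^ ω)
      ≤ p / ω * (a - b) ^ ω * (a ^ p / a ^ ω) := by
    gcongr
    linarith
  rw [h4]
  linarith

lemma aux_dir {U : Type*} [NormedAddCommGroup U] [NormedSpace ℝ U] (x y : U)
    (hy : y ≠ 0) (hyx : ‖y‖ ≤ ‖x‖) :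
    ‖‖x‖⁻¹ • x - ‖y‖⁻¹ • y‖ ≤ 2 * ‖x - y‖ / ‖x‖ := by
  have hb : 0 < ‖y‖ := norm_pos_iff.2 hy
  have ha : 0 < ‖x‖ := hb.trans_le hyx
  have e : ‖x‖⁻¹ • x - ‖y‖⁻¹ • y = ‖x‖⁻¹ • (x - y) + (‖x‖⁻¹ - ‖y‖⁻¹) • y := by
    rw [smul_sub, sub_smul]; abel
  have h1 : ‖x‖⁻¹ ≤ ‖y‖⁻¹ := inv_anti₀ hb hyx
  have h2 : ‖x‖ - ‖y‖ ≤ ‖x - y‖ := norm_sub_norm_le x y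
  calc _ ≤ ‖‖x‖⁻¹ • (x - y)‖ + ‖(‖x‖⁻¹ - ‖y‖⁻¹) • y‖ := by rw [e]; exact norm_add_le _ _
    _ = ‖x - y‖ / ‖x‖ + (‖x‖ - ‖y‖) / ‖x‖ := by
        rw [norm_smul, norm_smul, norm_inv, norm_norm, Real.norm_eq_abs,
          abs_of_nonpos (by linarith)]
        field_simp
        ring
    _ ≤ ‖x - y‖ / ‖x‖ + ‖x - y‖ / ‖x‖ := by gcongr
    _ = _ := by ring

lemma aux_main {U V : Type*} [NormedAddCommGroup U] [NormedSpace ℝ U]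
    [NormedAddCommGroup V] [NormedSpace ℝ V]
    (ω p C : ℝ) (hω0 : 0 < ω) (hω1 : ω ≤ 1) (hp : ω ≤ p) (hC : 0 < C)
    (g : U → V)
    (hsphere : ∀ x : U, ‖x‖ = 1 → ‖g x‖ = 1)
    (hHolder : ∀ x y : U, ‖x‖ = 1 → ‖y‖ = 1 → ‖g x - g y‖ ≤ C * ‖x - y‖ ^ ω)
    (x y : U) (hyx : ‖y‖ ≤ ‖x‖) :
      ‖radialExt p g x - radialExt p g y‖ ≤
        (p / ω + (2 : ℝ) ^ ω * C) * ‖x - y‖ ^ ω * ‖x‖ ^ (p - ω) := by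
  have hp0 : 0 < p := hω0.trans_le hp
  have hq : 1 ≤ p / ω := (one_le_div hω0).2 hp
  have hunit : ∀ z : U, z ≠ 0 → ‖‖z‖⁻¹ • z‖ = 1 := fun z hz => by
    rw [norm_smul, norm_inv, norm_norm, inv_mul_cancel₀ (norm_ne_zero_iff.2 hz)]
  by_cases hx : x = 0
  · have hy : y = 0 := by
      rw [hx, norm_zero] at hyx
      exact norm_le_zero_iff.1 hyx
    rw [hx, hy, sub_self, norm_zero]
    positivity
  have ha : 0 < ‖x‖ := norm_pos_iff.2 hx
  have hAp : 0 < ‖x‖ ^ p := Real.rpow_pos_of_pos ha _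
  by_cases hy : y = 0
  · have h2C : 0 < (2 : ℝ) ^ ω * C := by positivity
    have : ‖x‖ ^ ω * ‖x‖ ^ (p - ω) = ‖x‖ ^ p := by
      rw [← Real.rpow_add ha, add_sub_cancel]
    simp only [radialExt, hx, hy, if_true, if_false, sub_zero]
    rw [norm_smul, hsphere _ (hunit x hx), Real.norm_of_nonneg hAp.le, mul_assoc _ (_ ^ ω), this]
    nlinarith
  have hb : 0 < ‖y‖ := norm_pos_iff.2 hy
  have hBp : 0 < ‖y‖ ^ p := Real.rpow_pos_of_pos hb _
  have hle : ‖y‖ ^ p ≤ ‖x‖ ^ p := Real.rpow_le_rpow hb.le hyx hp0.le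
  simp only [radialExt, hx, hy, if_false]
  set u := ‖x‖⁻¹ • x with hu
  set v := ‖y‖⁻¹ • y with hv
  have e : ‖x‖ ^ p • g u - ‖y‖ ^ p • g v
      = (‖x‖ ^ p - ‖y‖ ^ p) • g u + ‖y‖ ^ p • (g u - g v) := by
    rw [smul_sub, sub_smul]; abel
  have h1 : ‖x‖ ^ p - ‖y‖ ^ p ≤ p / ω * ‖x - y‖ ^ ω * ‖x‖ ^ (p - ω) := by
    refine (aux_scalar ω p _ _ hω0 hω1 hp hb hyx).trans ?_
    have h0 : 0 ≤ ‖x‖ - ‖y‖ := sub_nonneg.2 hyx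
    have := Real.rpow_le_rpow h0 (norm_sub_norm_le x y) hω0.le
    gcongr
  have h2 : ‖g u - g v‖ ≤ C * (2 * ‖x - y‖ / ‖x‖) ^ ω := by
    refine (hHolder u v (hunit x hx) (hunit y hy)).trans ?_
    have := Real.rpow_le_rpow (norm_nonneg _) (aux_dir x y hy hyx) hω0.le
    gcongr
  have h3 : ‖x‖ ^ p * (C * (2 * ‖x - y‖ / ‖x‖) ^ ω)
      = 2 ^ ω * C * ‖x - y‖ ^ ω * ‖x‖ ^ (p - ω) := by
    rw [Real.div_rpow (by positivity) ha.le, Real.mul_rpow (by norm_num) (norm_nonneg _),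
      Real.rpow_sub ha]
    ring
  calc _ ≤ ‖(‖x‖ ^ p - ‖y‖ ^ p) • g u‖ + ‖‖y‖ ^ p • (g u - g v)‖ := by
        rw [e]; exact norm_add_le _ _
    _ = (‖x‖ ^ p - ‖y‖ ^ p) + ‖y‖ ^ p * ‖g u - g v‖ := by
        rw [norm_smul, norm_smul, hsphere _ (hunit x hx), Real.norm_of_nonneg hBp.le,
          Real.norm_of_nonneg (sub_nonneg.2 hle), mul_one]
    _ ≤ p / ω * ‖x - y‖ ^ ω * ‖x‖ ^ (p - ω) + ‖x‖ ^ p * (C * (2 * ‖x - y‖ / ‖x‖) ^ ω) := by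
        gcongr
    _ = _ := by rw [h3]; ring

/-- If `g : S_U → S_V` is `ω`-Hölder with constant `C` on the unit sphere and `p ≥ ω`,
then its degree-`p` radial extension satisfies
`‖g̃(x) - g̃(y)‖ ≤ (p/ω + 2^ω C) ‖x-y‖^ω · max(‖x‖,‖y‖)^{p-ω}`. -/
theorem stmt11 {U V : Type*} [NormedAddCommGroup U] [NormedSpace ℝ U]
    [NormedAddCommGroup V] [NormedSpace ℝ V]
    (ω p C : ℝ) (hω0 : 0 < ω) (hω1 : ω ≤ 1) (hp : ω ≤ p) (hC : 0 < C)
    (g : U → V)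
    (hsphere : ∀ x : U, ‖x‖ = 1 → ‖g x‖ = 1)
    (hHolder : ∀ x y : U, ‖x‖ = 1 → ‖y‖ = 1 → ‖g x - g y‖ ≤ C * ‖x - y‖ ^ ω) :
    ∀ x y : U,
      ‖radialExt p g x - radialExt p g y‖ ≤
        (p / ω + (2 : ℝ) ^ ω * C) * ‖x - y‖ ^ ω * (max ‖x‖ ‖y‖) ^ (p - ω) := by
  intro x y
  rcases le_total ‖y‖ ‖x‖ with h | h
  · rw [max_eq_left h]
    exact aux_main ω p C hω0 hω1 hp hC g hsphere hHolder x y h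
  · rw [max_eq_right h, norm_sub_rev, norm_sub_rev x y]
    exact aux_main ω p C hω0 hω1 hp hC g hsphere hHolder y x h
end

section
/- Let X and Y be real Banach spaces, let α, β ∈ (0,1] and K, L > 0, and let f : S_X → S_Y be a bijection between the unit spheres satisfying (1/L)·‖x − y‖_X^{1/β} ≤ ‖f(x) − f(y)‖_Y ≤ K·‖x − y‖_X^α for all x, y ∈ S_X. Let f̃ : X → Y be the degree-α radial extension of f, and let h : Y → X be the degree-(1/α) radial extension of f⁻¹. Then: (i) ‖f̃(x)‖_Y = ‖x‖_X^α for all x ∈ X; (ii) h is a two-sided inverse of f̃; (iii) ‖f̃(x) − f̃(y)‖_Y ≤ (1 + 2^α·K)·‖x − y‖_X^α for all x, y ∈ X; (iv) ‖h(u) − h(v)‖_X ≤ (1/(αβ) + 2^β·L^β)·‖u − v‖_Y^β · max(‖u‖_Y, ‖v‖_Y)^{1/α − β} for all u, v ∈ Y. -/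
open scoped Classical

theorem radialExt_norm {U V : Type*} [NormedAddCommGroup U] [NormedSpace ℝ U]
    [NormedAddCommGroup V] [NormedSpace ℝ V] (p : ℝ) (hp : 0 < p) (g : U → V)
    (hg : ∀ x : U, ‖x‖ = 1 → ‖g x‖ = 1) (x : U) : ‖radialExt p g x‖ = ‖x‖ ^ p := by
  unfold radialExt
  split_ifs with h
  · simp [h, Real.zero_rpow hp.ne']
  · have hx : ‖‖x‖⁻¹ • x‖ = 1 := norm_smul_inv_norm (𝕜 := ℝ) h
    rw [norm_smul, hg _ hx, mul_one, Real.norm_of_nonneg (by positivity)]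

theorem radialExt_leftInv {U V : Type*} [NormedAddCommGroup U] [NormedSpace ℝ U]
    [NormedAddCommGroup V] [NormedSpace ℝ V] (p q : ℝ) (hp : 0 < p) (hpq : p * q = 1)
    (g : U → V) (k : V → U)
    (hg : ∀ x : U, ‖x‖ = 1 → ‖g x‖ = 1) (hk : ∀ x : U, ‖x‖ = 1 → k (g x) = x) (x : U) :
    radialExt q k (radialExt p g x) = x := by
  have hn := radialExt_norm p hp g hg x
  by_cases h : x = 0
  · simp [h, radialExt]
  · have hx : ‖‖x‖⁻¹ • x‖ = 1 := norm_smul_inv_norm (𝕜 := ℝ) h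
    have h0 : 0 < ‖x‖ := norm_pos_iff.mpr h
    have h1 : 0 < ‖x‖ ^ p := by positivity
    have hne : radialExt p g x ≠ 0 := by
      rw [← norm_pos_iff, hn]; exact h1
    have he : radialExt p g x = ‖x‖ ^ p • g (‖x‖⁻¹ • x) := by simp [radialExt, h]
    have : ‖radialExt p g x‖⁻¹ • radialExt p g x = g (‖x‖⁻¹ • x) := by
      rw [hn, he, smul_smul, inv_mul_cancel₀ h1.ne', one_smul]
    rw [radialExt, if_neg hne, this, hk _ hx, hn, ← Real.rpow_mul h0.le, hpq, Real.rpow_one,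
      smul_smul, mul_inv_cancel₀ h0.ne', one_smul]

theorem radialExt_holder {U V : Type*} [NormedAddCommGroup U] [NormedSpace ℝ U]
    [NormedAddCommGroup V] [NormedSpace ℝ V] (p γ A C : ℝ) (hp : 0 < p) (hγ : 0 < γ)
    (hA0 : 0 ≤ A) (hC : 0 ≤ C)
    (hA : ∀ s t : ℝ, 0 ≤ s → s ≤ t → 0 < t → t ^ p - s ^ p ≤ A * (t - s) ^ γ * t ^ (p - γ))
    (g : U → V) (hg : ∀ x : U, ‖x‖ = 1 → ‖g x‖ = 1)
    (hgC : ∀ x y : U, ‖x‖ = 1 → ‖y‖ = 1 → ‖g x - g y‖ ≤ C * ‖x - y‖ ^ γ) (x y : U) :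
    ‖radialExt p g x - radialExt p g y‖ ≤
      (A + (2 : ℝ) ^ γ * C) * ‖x - y‖ ^ γ * (max ‖x‖ ‖y‖) ^ (p - γ) := by
  wlog hxy : ‖y‖ ≤ ‖x‖ generalizing x y
  · rw [norm_sub_rev, norm_sub_rev x y, max_comm]
    exact this y x (le_of_not_ge hxy)
  rw [max_eq_left hxy]
  by_cases hx0 : x = 0
  · have hy0 : y = 0 := by simpa [hx0] using hxy
    subst hx0 hy0
    simp only [sub_self, norm_zero]
    positivity
  have ht : 0 < ‖x‖ := norm_pos_iff.mpr hx0
  have hd : ‖x‖ - ‖y‖ ≤ ‖x - y‖ := norm_sub_norm_le x y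
  have h1 : ‖x‖ ^ p - ‖y‖ ^ p ≤ A * ‖x - y‖ ^ γ * ‖x‖ ^ (p - γ) := by
    refine (hA _ _ (norm_nonneg y) hxy ht).trans ?_
    have : 0 ≤ ‖x‖ - ‖y‖ := sub_nonneg.mpr hxy
    gcongr
  by_cases hy0 : y = 0
  · have h2 : radialExt p g y = 0 := by simp [radialExt, hy0]
    rw [h2, sub_zero, radialExt_norm p hp g hg]
    have h3 : ‖y‖ ^ p = 0 := by simp [hy0, Real.zero_rpow hp.ne']
    have : 0 ≤ (2 : ℝ) ^ γ * C * ‖x - y‖ ^ γ * ‖x‖ ^ (p - γ) := by positivity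
    linarith
  have hs : 0 < ‖y‖ := norm_pos_iff.mpr hy0
  have hx1 : ‖‖x‖⁻¹ • x‖ = 1 := norm_smul_inv_norm (𝕜 := ℝ) hx0
  have hy1 : ‖‖y‖⁻¹ • y‖ = 1 := norm_smul_inv_norm (𝕜 := ℝ) hy0
  have hu : ‖‖x‖⁻¹ • x - ‖y‖⁻¹ • y‖ ≤ 2 * ‖x - y‖ / ‖x‖ := by
    have e : ‖x‖⁻¹ • x - ‖y‖⁻¹ • y = ‖x‖⁻¹ • ((x - y) - (‖x‖ - ‖y‖) • (‖y‖⁻¹ • y)) := by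
      rw [sub_smul, smul_smul ‖y‖, mul_inv_cancel₀ hs.ne', one_smul]
      rw [show x - y - (‖x‖ • ‖y‖⁻¹ • y - y) = x - ‖x‖ • ‖y‖⁻¹ • y by abel, smul_sub,
        smul_smul ‖x‖⁻¹ ‖x‖, inv_mul_cancel₀ ht.ne', one_smul]
    have e2 : ‖(x - y) - (‖x‖ - ‖y‖) • (‖y‖⁻¹ • y)‖ ≤ 2 * ‖x - y‖ := by
      refine (norm_sub_le _ _).trans ?_
      rw [norm_smul, hy1, Real.norm_of_nonneg (sub_nonneg.mpr hxy)]
      linarith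
    rw [e, norm_smul, norm_inv, norm_norm, div_eq_inv_mul]
    gcongr
  have h2 : ‖y‖ ^ p * ‖g (‖x‖⁻¹ • x) - g (‖y‖⁻¹ • y)‖ ≤
      (2 : ℝ) ^ γ * C * ‖x - y‖ ^ γ * ‖x‖ ^ (p - γ) := by
    calc _ ≤ ‖x‖ ^ p * (C * (2 * ‖x - y‖ / ‖x‖) ^ γ) := by
          refine mul_le_mul (by gcongr) ((hgC _ _ hx1 hy1).trans (by gcongr)) (norm_nonneg _)
            (by positivity)
      _ = _ := by
          rw [Real.div_rpow (by positivity) ht.le, Real.mul_rpow (by norm_num) (norm_nonneg _),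
            Real.rpow_sub ht]
          ring
  have e : radialExt p g x - radialExt p g y = (‖x‖ ^ p - ‖y‖ ^ p) • g (‖x‖⁻¹ • x) +
      ‖y‖ ^ p • (g (‖x‖⁻¹ • x) - g (‖y‖⁻¹ • y)) := by
    simp only [radialExt, if_neg hx0, if_neg hy0, sub_smul, smul_sub]
    abel
  have hpos : 0 ≤ ‖x‖ ^ p - ‖y‖ ^ p := sub_nonneg.mpr (by gcongr)
  rw [e]
  refine (norm_add_le _ _).trans ?_
  rw [norm_smul, norm_smul, hg _ hx1, Real.norm_of_nonneg hpos,
    Real.norm_of_nonneg (by positivity : 0 ≤ ‖y‖ ^ p)]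
  linarith

/-- Radial extension of a bi-Hölder homeomorphism `f` between unit spheres of Banach
spaces: the degree-`α` radial extension `f̃` of `f` satisfies `‖f̃(x)‖ = ‖x‖^α`, has
the degree-`1/α` radial extension of `f⁻¹` as a two-sided inverse, is `α`-Hölder with
constant `1 + 2^α K`, and its inverse satisfies the stated Hölder-type estimate. -/
theorem stmt12 {X Y : Type*} [NormedAddCommGroup X] [NormedSpace ℝ X] [CompleteSpace X]
    [NormedAddCommGroup Y] [NormedSpace ℝ Y] [CompleteSpace Y]
    (α β K L : ℝ) (hα0 : 0 < α) (hα1 : α ≤ 1) (hβ0 : 0 < β) (hβ1 : β ≤ 1)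
    (hK : 0 < K) (hL : 0 < L)
    (f : X → Y) (finv : Y → X)
    (hf : ∀ x : X, ‖x‖ = 1 → ‖f x‖ = 1)
    (hfinv : ∀ y : Y, ‖y‖ = 1 → ‖finv y‖ = 1)
    (hleft : ∀ x : X, ‖x‖ = 1 → finv (f x) = x)
    (hright : ∀ y : Y, ‖y‖ = 1 → f (finv y) = y)
    (hlower : ∀ x y : X, ‖x‖ = 1 → ‖y‖ = 1 →
      (1 / L) * ‖x - y‖ ^ (1 / β) ≤ ‖f x - f y‖)
    (hupper : ∀ x y : X, ‖x‖ = 1 → ‖y‖ = 1 → ‖f x - f y‖ ≤ K * ‖x - y‖ ^ α) :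
    (∀ x : X, ‖radialExt α f x‖ = ‖x‖ ^ α) ∧
    (∀ x : X, radialExt (1 / α) finv (radialExt α f x) = x) ∧
    (∀ y : Y, radialExt α f (radialExt (1 / α) finv y) = y) ∧
    (∀ x y : X,
      ‖radialExt α f x - radialExt α f y‖ ≤ (1 + (2 : ℝ) ^ α * K) * ‖x - y‖ ^ α) ∧
    (∀ u v : Y,
      ‖radialExt (1 / α) finv u - radialExt (1 / α) finv v‖ ≤
        (1 / (α * β) + (2 : ℝ) ^ β * L ^ β) * ‖u - v‖ ^ β *
          (max ‖u‖ ‖v‖) ^ (1 / α - β)) := by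
  have hα' : 0 < 1 / α := by positivity
  refine ⟨radialExt_norm α hα0 f hf,
    radialExt_leftInv α (1 / α) hα0 (by field_simp) f finv hf hleft,
    radialExt_leftInv (1 / α) α hα' (by field_simp) finv f hfinv hright, ?_, ?_⟩
  · intro x y
    have := radialExt_holder α α 1 K hα0 hα0 zero_le_one hK.le (by
      intro s t hs hst ht
      have h := Real.rpow_add_le_add_rpow (sub_nonneg.mpr hst) hs hα0.le hα1
      simp only [sub_add_cancel] at h
      simp only [sub_self, Real.rpow_zero]
      linarith) f hf hupper x y
    simpa using this
  · refine radialExt_holder (1 / α) β (1 / (α * β)) (L ^ β) hα' hβ0 (by positivity)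
      (by positivity) ?_ finv hfinv ?_ |> fun h u v => h u v
    · intro s t hs hst ht
      have hp1 : 1 ≤ 1 / α := by rw [le_div_iff₀ hα0]; linarith
      have hr0 : 0 ≤ s / t := by positivity
      have hr1 : s / t ≤ 1 := (div_le_one ht).mpr hst
      have hb := one_add_mul_self_le_rpow_one_add (s := s / t - 1) (by linarith) hp1
      rw [add_sub_cancel] at hb
      have hc : 1 - s / t ≤ (1 - s / t) ^ β := by
        have := Real.rpow_le_rpow_of_exponent_ge' (x := 1 - s / t) (by linarith) (by linarith)
          hβ0.le hβ1
        rwa [Real.rpow_one] at this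
      have hd : 1 - (s / t) ^ (1 / α) ≤ 1 / (α * β) * (1 - s / t) ^ β := by
        have h1 : 1 / α ≤ 1 / (α * β) := by
          apply one_div_le_one_div_of_le (by positivity)
          nlinarith
        calc _ ≤ 1 / α * (1 - s / t) := by linarith
          _ ≤ _ := mul_le_mul h1 hc (by linarith) (by positivity)
      have he : 1 - s / t = (t - s) / t := by field_simp
      rw [he, Real.div_rpow hs ht.le, Real.div_rpow (by linarith) ht.le] at hd
      have htp : 0 < t ^ (1 / α) := by positivity
      have := mul_le_mul_of_nonneg_left hd htp.le
      rw [Real.rpow_sub ht]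
      calc _ = t ^ (1 / α) * (1 - s ^ (1 / α) / t ^ (1 / α)) := by field_simp
        _ ≤ _ := this
        _ = _ := by ring
    · intro x y hx hy
      have h := hlower _ _ (hfinv x hx) (hfinv y hy)
      rw [hright x hx, hright y hy, one_div_mul_eq_div, div_le_iff₀ hL] at h
      have h2 := Real.rpow_le_rpow (by positivity) h hβ0.le
      rw [← Real.rpow_mul (norm_nonneg _), one_div_mul_cancel hβ0.ne', Real.rpow_one,
        Real.mul_rpow (norm_nonneg _) hL.le] at h2
      linarith
end

section
/- Let X and Y be real Banach spaces, let α ∈ (0,1], q ≥ 1, and K > 0, and let f : S_X → S_Y satisfy ‖f(x) − f(y)‖_Y ≤ K·‖x − y‖_X^α for all x, y ∈ S_X. Let f̃ be the degree-α radial extension of f, let P ⊆ X be a set of n ≥ 1 points, let t ∈ X, and define g : X → Y by g(x) = f̃(x − t). Suppose C ≥ 1 and ε ≥ 0 satisfy ε ≤ (1/2)·((1/(2n²)) Σ_{x∈P} Σ_{y∈P} ‖x − y‖_X^{qα})^{1/q}, and suppose (1/n) Σ_{x∈P} ‖g(x)‖_Y^q ≤ C^q · inf_{z∈Y} (1/n)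 Σ_{x∈P} ‖g(x) − z‖_Y^q + ε^q (i.e., 0 is a (C,ε)-approximate q-mean of g(P)). Then ‖g(x) − g(y)‖_Y ≤ (1 + 2^α·K)·‖x − y‖_X^α for all x, y ∈ X, and Σ_{x∈P} Σ_{y∈P} ‖x − y‖_X^{qα} ≤ 2^{q+1}·C^q · Σ_{x∈P} Σ_{y∈P} ‖g(x) − g(y)‖_Y^q; that is, g embeds the α-snowflake of X into Y with q-average distortion at most 2^{1+1/q}·C·(1 + 2^α·K) with respect to P. -/
open scoped Classical

open Finset

theorem norm_radialExt_aux {X Y : Type*} [NormedAddCommGroup X] [NormedSpace ℝ X]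
    [NormedAddCommGroup Y] [NormedSpace ℝ Y] (α : ℝ) (hα0 : 0 < α) (f : X → Y)
    (hf : ∀ x : X, ‖x‖ = 1 → ‖f x‖ = 1) (x : X) : ‖radialExt α f x‖ = ‖x‖ ^ α := by
  unfold radialExt
  split_ifs with h
  · simp [h, Real.zero_rpow hα0.ne']
  · have h1 : ‖‖x‖⁻¹ • x‖ = 1 := by
      rw [norm_smul, norm_inv, norm_norm, inv_mul_cancel₀ (norm_ne_zero_iff.2 h)]
    rw [norm_smul, hf _ h1, mul_one, Real.norm_of_nonneg (by positivity)]

theorem radialExt_holder_aux {X Y : Type*} [NormedAddCommGroup X] [NormedSpace ℝ X]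
    [NormedAddCommGroup Y] [NormedSpace ℝ Y]
    (α K : ℝ) (hα0 : 0 < α) (hα1 : α ≤ 1) (hK : 0 < K) (f : X → Y)
    (hf : ∀ x : X, ‖x‖ = 1 → ‖f x‖ = 1)
    (hHolder : ∀ x y : X, ‖x‖ = 1 → ‖y‖ = 1 → ‖f x - f y‖ ≤ K * ‖x - y‖ ^ α)
    (x y : X) (hxy : ‖y‖ ≤ ‖x‖) :
    ‖radialExt α f x - radialExt α f y‖ ≤ (1 + (2 : ℝ) ^ α * K) * ‖x - y‖ ^ α := by
  by_cases hy : y = 0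
  · subst hy
    have h0 : radialExt α f (0 : X) = 0 := by simp [radialExt]
    rw [h0, sub_zero, sub_zero, norm_radialExt_aux α hα0 f hf]
    have : 0 ≤ (2 : ℝ) ^ α * K * ‖x‖ ^ α := by positivity
    linarith
  have hyp : 0 < ‖y‖ := norm_pos_iff.2 hy
  have hxp : 0 < ‖x‖ := hyp.trans_le hxy
  have hx : x ≠ 0 := norm_pos_iff.1 hxp
  have h1 : ∀ z : X, z ≠ 0 → ‖‖z‖⁻¹ • z‖ = 1 := fun z h => by
    rw [norm_smul, norm_inv, norm_norm, inv_mul_cancel₀ (norm_ne_zero_iff.2 h)]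
  have e : radialExt α f x - radialExt α f y =
      (‖x‖ ^ α - ‖y‖ ^ α) • f (‖x‖⁻¹ • x) +
        ‖y‖ ^ α • (f (‖x‖⁻¹ • x) - f (‖y‖⁻¹ • y)) := by
    simp only [radialExt, hx, hy, if_false]
    module
  have hd : ‖x‖ - ‖y‖ ≤ ‖x - y‖ := norm_sub_norm_le x y
  have b1 : ‖x‖ ^ α - ‖y‖ ^ α ≤ ‖x - y‖ ^ α := by
    have h2 := Real.rpow_add_le_add_rpow (sub_nonneg.2 hxy) hyp.le hα0.le hα1
    rw [sub_add_cancel] at h2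
    have h3 := Real.rpow_le_rpow (sub_nonneg.2 hxy) hd hα0.le
    linarith
  have b0 : 0 ≤ ‖x‖ ^ α - ‖y‖ ^ α :=
    sub_nonneg.2 (Real.rpow_le_rpow hyp.le hxy hα0.le)
  have b2 : ‖y‖ * ‖‖x‖⁻¹ • x - ‖y‖⁻¹ • y‖ ≤ 2 * ‖x - y‖ := by
    have e2 : ‖y‖ • (‖x‖⁻¹ • x - ‖y‖⁻¹ • y) = (x - y) - ((‖x‖ - ‖y‖) * ‖x‖⁻¹) • x := by
      rw [smul_sub, smul_smul, smul_smul, mul_inv_cancel₀ hyp.ne', sub_mul,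
        mul_inv_cancel₀ hxp.ne']
      module
    have e3 : ‖((‖x‖ - ‖y‖) * ‖x‖⁻¹) • x‖ = ‖x‖ - ‖y‖ := by
      rw [mul_smul, norm_smul, h1 x hx, mul_one, Real.norm_of_nonneg (sub_nonneg.2 hxy)]
    calc ‖y‖ * ‖‖x‖⁻¹ • x - ‖y‖⁻¹ • y‖ = ‖‖y‖ • (‖x‖⁻¹ • x - ‖y‖⁻¹ • y)‖ := by
          rw [norm_smul, norm_norm]
      _ ≤ ‖x - y‖ + ‖((‖x‖ - ‖y‖) * ‖x‖⁻¹) • x‖ := by rw [e2]; exact norm_sub_le _ _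
      _ ≤ _ := by rw [e3]; linarith
  have b3 : ‖y‖ ^ α * ‖‖x‖⁻¹ • x - ‖y‖⁻¹ • y‖ ^ α ≤ 2 ^ α * ‖x - y‖ ^ α := by
    rw [← Real.mul_rpow (norm_nonneg _) (norm_nonneg _),
      ← Real.mul_rpow zero_le_two (norm_nonneg _)]
    exact Real.rpow_le_rpow (by positivity) b2 hα0.le
  rw [e]
  refine (norm_add_le _ _).trans ?_
  rw [norm_smul, norm_smul, hf _ (h1 x hx), mul_one, Real.norm_of_nonneg b0,
    Real.norm_of_nonneg (by positivity : 0 ≤ ‖y‖ ^ α)]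
  have b4 := mul_le_mul_of_nonneg_left (hHolder _ _ (h1 x hx) (h1 y hy))
    (by positivity : 0 ≤ ‖y‖ ^ α)
  have b5 := mul_le_mul_of_nonneg_left b3 hK.le
  linarith

/-- If `f : S_X → S_Y` is `α`-Hölder with constant `K` on the unit sphere, `f̃` is its
degree-`α` radial extension, and `0` is a `(C,ε)`-approximate `q`-mean of the image of
`P` under `g(x) = f̃(x - t)` (with `ε` small compared to the average `qα`-th power of
distances in `P`), then `g` embeds the `α`-snowflake of `X` into `Y` with `q`-average
distortion at most `2^{1+1/q}·C·(1 + 2^α K)` with respect to `P`. -/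
theorem stmt13 {X Y : Type*} [NormedAddCommGroup X] [NormedSpace ℝ X] [CompleteSpace X]
    [NormedAddCommGroup Y] [NormedSpace ℝ Y] [CompleteSpace Y]
    (α q K : ℝ) (hα0 : 0 < α) (hα1 : α ≤ 1) (hq : 1 ≤ q) (hK : 0 < K)
    (f : X → Y)
    (hf : ∀ x : X, ‖x‖ = 1 → ‖f x‖ = 1)
    (hHolder : ∀ x y : X, ‖x‖ = 1 → ‖y‖ = 1 → ‖f x - f y‖ ≤ K * ‖x - y‖ ^ α)
    (P : Finset X) (hP : P.Nonempty) (t : X)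
    (C ε : ℝ) (hC : 1 ≤ C) (hε0 : 0 ≤ ε)
    (hε : ε ≤ (1 / 2) *
      ((1 / (2 * (P.card : ℝ) ^ 2)) * ∑ x ∈ P, ∑ y ∈ P, ‖x - y‖ ^ (q * α)) ^ (1 / q))
    (hmean : (1 / (P.card : ℝ)) * ∑ x ∈ P, ‖radialExt α f (x - t)‖ ^ q ≤
      C ^ q *
          sInf {v : ℝ | ∃ z : Y,
            v = (1 / (P.card : ℝ)) * ∑ x ∈ P, ‖radialExt α f (x - t) - z‖ ^ q} +
        ε ^ q) :
    (∀ x y : X,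
      ‖radialExt α f (x - t) - radialExt α f (y - t)‖ ≤
        (1 + (2 : ℝ) ^ α * K) * ‖x - y‖ ^ α) ∧
    ∑ x ∈ P, ∑ y ∈ P, ‖x - y‖ ^ (q * α) ≤
      (2 : ℝ) ^ (q + 1) * C ^ q *
        ∑ x ∈ P, ∑ y ∈ P, ‖radialExt α f (x - t) - radialExt α f (y - t)‖ ^ q := by
  refine ⟨fun x y => ?_, ?_⟩
  · have hs : x - y = (x - t) - (y - t) := by abel
    rw [hs]
    rcases le_total ‖y - t‖ ‖x - t‖ with h | h
    · exact radialExt_holder_aux α K hα0 hα1 hK f hf hHolder _ _ h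
    · rw [norm_sub_rev, norm_sub_rev (x - t)]
      exact radialExt_holder_aux α K hα0 hα1 hK f hf hHolder _ _ h
  have hq0 : 0 < q := by linarith
  have hn : 0 < (P.card : ℝ) := by exact_mod_cast hP.card_pos
  set n : ℝ := (P.card : ℝ) with hndef
  set D := ∑ x ∈ P, ∑ y ∈ P, ‖x - y‖ ^ (q * α) with hD
  set S := ∑ x ∈ P, ‖radialExt α f (x - t)‖ ^ q with hS
  set G := ∑ x ∈ P, ∑ y ∈ P, ‖radialExt α f (x - t) - radialExt α f (y - t)‖ ^ q with hG
  set I := sInf {v : ℝ | ∃ z : Y,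
            v = (1 / n) * ∑ x ∈ P, ‖radialExt α f (x - t) - z‖ ^ q} with hI
  have hD0 : 0 ≤ D := Finset.sum_nonneg fun x _ => Finset.sum_nonneg fun y _ => by positivity
  have hεq : ε ^ q ≤ (1 / 2) ^ q * (1 / (2 * n ^ 2) * D) := by
    have h := Real.rpow_le_rpow hε0 hε hq0.le
    rwa [Real.mul_rpow (by norm_num) (by positivity), ← Real.rpow_mul (by positivity),
      one_div_mul_cancel hq0.ne', Real.rpow_one] at h
  have hDS : D ≤ 2 ^ q * n * S := by
    have hpt : ∀ x ∈ P, ∀ y ∈ P, ‖x - y‖ ^ (q * α) ≤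
        2 ^ (q - 1) * (‖radialExt α f (x - t)‖ ^ q + ‖radialExt α f (y - t)‖ ^ q) := by
      intro x _ y _
      rw [norm_radialExt_aux α hα0 f hf, norm_radialExt_aux α hα0 f hf]
      have h1 : ‖x - y‖ ≤ ‖x - t‖ + ‖y - t‖ := by
        have := norm_sub_le (x - t) (y - t)
        rwa [sub_sub_sub_cancel_right] at this
      have h2 : ‖x - y‖ ^ α ≤ ‖x - t‖ ^ α + ‖y - t‖ ^ α :=
        (Real.rpow_le_rpow (norm_nonneg _) h1 hα0.le).trans
          (Real.rpow_add_le_add_rpow (norm_nonneg _) (norm_nonneg _) hα0.le hα1)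
      rw [mul_comm q α, Real.rpow_mul (norm_nonneg _)]
      refine (Real.rpow_le_rpow (by positivity) h2 hq0.le).trans ?_
      have h3 := NNReal.rpow_add_le_mul_rpow_add_rpow
        (⟨‖x - t‖ ^ α, by positivity⟩) (⟨‖y - t‖ ^ α, by positivity⟩) hq
      exact_mod_cast h3
    have h4 : D ≤ ∑ x ∈ P, ∑ y ∈ P,
        2 ^ (q - 1) * (‖radialExt α f (x - t)‖ ^ q + ‖radialExt α f (y - t)‖ ^ q) :=
      Finset.sum_le_sum fun x hx => Finset.sum_le_sum fun y hy => hpt x hx y hy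
    refine h4.trans (le_of_eq ?_)
    simp only [← Finset.mul_sum, Finset.sum_add_distrib, Finset.sum_const, nsmul_eq_mul]
    rw [← hS, ← hndef, Real.rpow_sub_one two_ne_zero]
    ring
  have hIG : n ^ 2 * I ≤ G := by
    have hb : ∀ y ∈ P, n * I ≤
        ∑ x ∈ P, ‖radialExt α f (x - t) - radialExt α f (y - t)‖ ^ q := by
      intro y _
      have h5 : I ≤ (1 / n) *
          ∑ x ∈ P, ‖radialExt α f (x - t) - radialExt α f (y - t)‖ ^ q := by
        refine csInf_le ⟨0, ?_⟩ ⟨_, rfl⟩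
        rintro v ⟨z, rfl⟩
        positivity
      have h6 := mul_le_mul_of_nonneg_left h5 hn.le
      rwa [← mul_assoc, mul_one_div_cancel hn.ne', one_mul] at h6
    have h7 := Finset.sum_le_sum hb
    rw [Finset.sum_const, nsmul_eq_mul, Finset.sum_comm, ← hndef] at h7
    linarith
  have hC0 : 0 ≤ C ^ q := Real.rpow_nonneg (by linarith) _
  have h2q : (0 : ℝ) < 2 ^ q := by positivity
  have hhalf : (1 / 2 : ℝ) ^ q = 1 / 2 ^ q := by
    rw [Real.div_rpow zero_le_one zero_le_two, Real.one_rpow]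
  rw [hhalf] at hεq
  have k1 : 1 / n * S ≤ C ^ q * I + 1 / 2 ^ q * (1 / (2 * n ^ 2) * D) := by linarith
  have k2 := mul_le_mul_of_nonneg_left k1 (by positivity : 0 ≤ 2 ^ q * n ^ 2)
  have k3 : 2 ^ q * n ^ 2 * (1 / n * S) = 2 ^ q * n * S := by field_simp
  have k4 : 2 ^ q * n ^ 2 * (C ^ q * I + 1 / 2 ^ q * (1 / (2 * n ^ 2) * D)) =
      2 ^ q * C ^ q * (n ^ 2 * I) + D / 2 := by field_simp
  have k5 := mul_le_mul_of_nonneg_left hIG (by positivity : 0 ≤ 2 ^ q * C ^ q)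
  rw [Real.rpow_add_one two_ne_zero]
  linarith
end

section
/- Let X be a finite-dimensional real normed space and let h : X → X be a continuous map such that for every A ∈ ℝ there exists M ∈ ℝ with ‖t‖ − ‖h(t) − t‖ ≥ A for all t ∈ X with ‖t‖ ≥ M (equivalently, lim_{M→∞} inf_{‖t‖ ≥ M} (‖t‖ − ‖h(t) − t‖) = ∞). Then h is surjective. -/
open Set Filter Topology MeasureTheory

lemma aux_poly {E : Type*} [NormedAddCommGroup E] [NormedSpace ℝ E] [FiniteDimensional ℝ E]
    (A : E →L[ℝ] E) : ∃ P : Polynomial ℝ, P.natDegree ≤ Module.finrank ℝ E ∧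
      ∀ t : ℝ, P.eval t = (ContinuousLinearMap.id ℝ E + t • A).det := by
  classical
  let b := Module.finBasis ℝ E
  let M := LinearMap.toMatrix b b (A : E →ₗ[ℝ] E)
  refine ⟨Matrix.det ((Polynomial.X : Polynomial ℝ) • M.map Polynomial.C
    + (1 : Matrix _ _ ℝ).map Polynomial.C), ?_, ?_⟩
  · simpa using Polynomial.natDegree_det_X_add_C_le M 1
  · intro t
    rw [← Polynomial.coe_evalRingHom, RingHom.map_det, ContinuousLinearMap.det, ← LinearMap.det_toMatrix b]
    congr 1
    ext i j
    simp [M, LinearMap.toMatrix_apply, Matrix.one_apply]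
    rw [Finsupp.single_apply]
    by_cases hij : i = j
    · subst hij; simp; ring
    · simp [hij, Ne.symm hij]; ring

lemma aux_lagrange (n : ℕ) (ε : ℝ) (hε : 0 < ε) : ∃ v c : ℕ → ℝ,
    (∀ i, 0 < v i ∧ v i ≤ ε) ∧ ∀ P : Polynomial ℝ, P.natDegree ≤ n →
      P.eval 1 = ∑ i ∈ Finset.range (n + 1), c i * P.eval (v i) := by
  let v : ℕ → ℝ := fun i => ε / (i + 1)
  have hv : Function.Injective v := by
    intro i j hij
    simp only [v] at hij
    have h1 : (i : ℝ) + 1 ≠ 0 := by positivity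
    have h2 : (j : ℝ) + 1 ≠ 0 := by positivity
    field_simp at hij
    have : (j : ℝ) = i := by linarith
    exact_mod_cast this.symm
  refine ⟨v, fun i => (Lagrange.basis (Finset.range (n + 1)) v i).eval 1, ?_, ?_⟩
  · intro i
    refine ⟨by positivity, div_le_self hε.le ?_⟩
    have : (0 : ℝ) ≤ i := by positivity
    linarith
  · intro P hP
    have hd : P.degree < (Finset.range (n + 1)).card := by
      rw [Finset.card_range]
      exact lt_of_le_of_lt (Polynomial.degree_le_of_natDegree_le hP) (by exact_mod_cast Nat.lt_succ_self n)
    have := Lagrange.eq_interpolate_of_eval_eq (s := Finset.range (n+1)) (v := v) (r := fun i => P.eval (v i)) hv.injOn hd (by simp)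
    conv_lhs => rw [this]
    rw [Lagrange.interpolate_apply, Polynomial.eval_finsetSum]
    refine Finset.sum_congr rfl fun i _ => ?_
    simp [mul_comm]

lemma aux_bij {E : Type*} [NormedAddCommGroup E] [InnerProductSpace ℝ E] [FiniteDimensional ℝ E]
    (R : ℝ) (hR : 0 < R) (f : E → E) (hf : ContDiff ℝ 1 f)
    (hfR : ∀ x, ‖f x‖ = R) (hfix : ∀ x, ‖x‖ = R → f x = x) :
    ∃ ε > 0, ∀ t : ℝ, 0 < t → t ≤ ε →
      InjOn (fun x => x + t • (f x - x)) (Metric.ball 0 R) ∧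
      (fun x => x + t • (f x - x)) '' (Metric.ball 0 R) = Metric.ball 0 R ∧
      ∀ x ∈ Metric.ball (0 : E) R, 0 < (ContinuousLinearMap.id ℝ E + t • (fderiv ℝ f x - ContinuousLinearMap.id ℝ E)).det := by
  have hK : IsCompact (Metric.closedBall (0 : E) R) := isCompact_closedBall 0 R
  set g : E → E := fun x => f x - x with hg
  have hgC : ContDiff ℝ 1 g := hf.sub contDiff_id
  obtain ⟨L, hL⟩ := hgC.contDiffOn.exists_lipschitzOnWith (s := Metric.closedBall 0 R) one_ne_zero (convex_closedBall 0 R) hK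
  have hcont' : Continuous (fderiv ℝ f) := hf.continuous_fderiv one_ne_zero
  obtain ⟨C, hC⟩ := hK.exists_bound_of_continuousOn
    (f := fun x => fderiv ℝ f x - ContinuousLinearMap.id ℝ E) (by fun_prop)
  have hdet : ∀ᶠ B in 𝓝 (ContinuousLinearMap.id ℝ E), 0 < B.det := by
    have : ContinuousAt (fun B : E →L[ℝ] E => B.det) (ContinuousLinearMap.id ℝ E) :=
      ContinuousLinearMap.continuous_det.continuousAt
    apply this.eventually_const_lt
    simp [ContinuousLinearMap.det]
  obtain ⟨η, hη, hdet⟩ := Metric.eventually_nhds_iff.1 hdet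
  have hC0 : 0 ≤ C := (norm_nonneg _).trans (hC 0 (by simp [hR.le]))
  have hfd : ∀ x, HasFDerivAt f (fderiv ℝ f x) x := fun x => (hf.differentiable one_ne_zero x).hasFDerivAt
  refine ⟨min (1 / 2) (min (1 / (2 * (L + 1))) (η / (2 * (C + 1)))), by positivity, ?_⟩
  intro t ht0 ht
  obtain ⟨ht1, ht⟩ := le_min_iff.1 ht
  obtain ⟨ht2, ht3⟩ := le_min_iff.1 ht
  have hL0 : (0:ℝ) ≤ L := L.2
  have htL : t * L < 1 := by
    rw [le_div_iff₀ (by positivity)] at ht2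
    nlinarith
  have htC : t * C < η := by
    rw [le_div_iff₀ (by positivity)] at ht3
    nlinarith
  have hpos : ∀ x ∈ Metric.ball (0 : E) R, 0 < (ContinuousLinearMap.id ℝ E + t • (fderiv ℝ f x - ContinuousLinearMap.id ℝ E)).det := by
    intro x hx
    apply hdet
    rw [dist_eq_norm, add_sub_cancel_left, norm_smul, Real.norm_of_nonneg ht0.le]
    exact (mul_le_mul_of_nonneg_left (hC x (Metric.ball_subset_closedBall hx)) ht0.le).trans_lt htC
  set F : E → E := fun x => x + t • g x with hF
  have hFC : ContDiff ℝ 1 F := contDiff_id.add (hgC.const_smul t)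
  have hFd : ∀ x, HasFDerivAt F (ContinuousLinearMap.id ℝ E + t • (fderiv ℝ f x - ContinuousLinearMap.id ℝ E)) x := by
    intro x
    exact (hasFDerivAt_id x).add (((hfd x).sub (hasFDerivAt_id x)).const_smul t)
  have hmaps : ∀ x ∈ Metric.ball (0 : E) R, F x ∈ Metric.ball (0 : E) R := by
    intro x hx
    rw [mem_ball_zero_iff] at *
    have : F x = (1 - t) • x + t • f x := by simp only [hF, hg]; module
    rw [this]
    calc _ ≤ ‖(1 - t) • x‖ + ‖t • f x‖ := norm_add_le _ _
      _ = (1 - t) * ‖x‖ + t * R := by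
        rw [norm_smul, norm_smul, hfR, Real.norm_of_nonneg ht0.le, Real.norm_of_nonneg (by linarith)]
      _ < R := by nlinarith
  refine ⟨?_, ?_, hpos⟩
  · intro x hx y hy hxy
    have h1 := hL.dist_le_mul x (Metric.ball_subset_closedBall hx) y (Metric.ball_subset_closedBall hy)
    rw [dist_eq_norm, dist_eq_norm] at h1
    have hxy' : x + t • g x = y + t • g y := hxy
    have h2 : x - y = -(t • (g x - g y)) := by
      rw [smul_sub, neg_sub, sub_eq_sub_iff_add_eq_add, hxy', add_comm]
    have h3 : ‖x - y‖ = t * ‖g x - g y‖ := by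
      conv_lhs => rw [h2, norm_neg, norm_smul, Real.norm_of_nonneg ht0.le]
    have h4 : ‖x - y‖ ≤ (t * L) * ‖x - y‖ := by
      rw [mul_assoc]; conv_lhs => rw [h3]
      exact mul_le_mul_of_nonneg_left h1 ht0.le
    have h5 : ‖x - y‖ = 0 := by
      have := norm_nonneg (x - y)
      nlinarith
    exact sub_eq_zero.1 (norm_eq_zero.1 h5)
  · apply Subset.antisymm
    · rintro _ ⟨x, hx, rfl⟩
      exact hmaps x hx
    · have h0 : (0 : E) ∈ Metric.ball (0 : E) R := by simp [hR]
      apply (convex_ball (0 : E) R).isPreconnected.subset_of_closure_inter_subset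
      · rw [isOpen_iff_mem_nhds]
        rintro _ ⟨x, hx, rfl⟩
        have hs : HasStrictFDerivAt F (ContinuousLinearMap.id ℝ E + t • (fderiv ℝ f x - ContinuousLinearMap.id ℝ E)) x :=
          hFC.contDiffAt.hasStrictFDerivAt' (hFd x) one_ne_zero
        have := HasStrictFDerivAt.map_nhds_eq_of_equiv (f' := ContinuousLinearMap.toContinuousLinearEquivOfDetNeZero _ (hpos x hx).ne') (by simpa using hs)
        change F '' _ ∈ 𝓝 (F x)
        rw [← this]
        exact image_mem_map (Metric.isOpen_ball.mem_nhds hx)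
      · exact ⟨F 0, hmaps 0 h0, 0, h0, rfl⟩
      · rintro y ⟨hy, hyb⟩
        have hcl : IsClosed (F '' Metric.closedBall 0 R) := (hK.image hFC.continuous).isClosed
        obtain ⟨x, hx, rfl⟩ := closure_minimal (image_mono Metric.ball_subset_closedBall) hcl hy
        rcases (mem_closedBall_zero_iff.1 hx).lt_or_eq with h | h
        · exact ⟨x, mem_ball_zero_iff.2 h, rfl⟩
        · exfalso
          have : F x = x := by simp [hF, hg, hfix x h]
          rw [this, mem_ball_zero_iff] at hyb
          linarith

lemma aux_noretract {E : Type*} [NormedAddCommGroup E] [InnerProductSpace ℝ E] [FiniteDimensional ℝ E]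
    (R : ℝ) (hR : 0 < R) (f : E → E) (hf : ContDiff ℝ 1 f)
    (hfR : ∀ x, ‖f x‖ = R) (hfix : ∀ x, ‖x‖ = R → f x = x) : False := by
  let _ : MeasurableSpace E := borel E
  have : BorelSpace E := ⟨rfl⟩
  let μ : Measure E := Measure.addHaar
  obtain ⟨ε, hε, H⟩ := aux_bij R hR f hf hfR hfix
  obtain ⟨v, c, hv, hP⟩ := aux_lagrange (Module.finrank ℝ E) ε hε
  have hcont' : Continuous (fderiv ℝ f) := hf.continuous_fderiv one_ne_zero
  have hfd : ∀ x, HasFDerivAt f (fderiv ℝ f x) x := fun x => (hf.differentiable one_ne_zero x).hasFDerivAt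
  let D : ℝ → E → ℝ := fun t x => (ContinuousLinearMap.id ℝ E + t • (fderiv ℝ f x - ContinuousLinearMap.id ℝ E)).det
  have hDc : ∀ t, Continuous (D t) := fun t =>
    ContinuousLinearMap.continuous_det.comp (by fun_prop)
  have hDi : ∀ t, IntegrableOn (D t) (Metric.ball 0 R) μ := fun t =>
    ((hDc t).continuousOn.integrableOn_compact (isCompact_closedBall (0:E) R)).mono_set Metric.ball_subset_closedBall
  have hvol : ∀ i, ∫ x in Metric.ball 0 R, D (v i) x ∂μ = μ.real (Metric.ball 0 R) := by
    intro i
    obtain ⟨h1, h2, h3⟩ := H (v i) (hv i).1 (hv i).2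
    have := integral_image_eq_integral_abs_det_fderiv_smul μ (s := Metric.ball (0:E) R) (f := fun x => x + v i • (f x - x))
      (f' := fun x => ContinuousLinearMap.id ℝ E + v i • (fderiv ℝ f x - ContinuousLinearMap.id ℝ E))
      Metric.isOpen_ball.measurableSet
      (fun x _ => ((hasFDerivAt_id x).add (((hfd x).sub (hasFDerivAt_id x)).const_smul (v i))).hasFDerivWithinAt) h1 (fun _ => (1:ℝ))
    rw [h2] at this
    simp only [integral_const, smul_eq_mul, mul_one, measureReal_restrict_apply_univ] at this
    rw [this]
    refine setIntegral_congr_fun Metric.isOpen_ball.measurableSet fun x hx => ?_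
    exact (abs_of_pos (h3 x hx)).symm
  have hsum : ∀ x, D 1 x = ∑ i ∈ Finset.range (Module.finrank ℝ E + 1), c i * D (v i) x := by
    intro x
    obtain ⟨P, hPd, hPe⟩ := aux_poly (fderiv ℝ f x - ContinuousLinearMap.id ℝ E)
    have := hP P hPd
    simpa only [hPe] using this
  have hzero : ∀ x, D 1 x = 0 := by
    intro x
    by_contra hne
    have hinner : ∀ w, inner ℝ (f x) (fderiv ℝ f x w) = 0 := by
      intro w
      have h1 := ((hfd x).inner ℝ (hfd x))
      have h2 : (fun y => inner ℝ (f y) (f y)) = fun _ : E => R ^ 2 := by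
        funext y; rw [real_inner_self_eq_norm_sq, hfR]
      rw [h2] at h1
      have h3 := h1.unique (hasFDerivAt_const _ _)
      have h4 := congrArg (fun T => T w) h3
      simp [real_inner_comm] at h4
      exact h4
    have hne' : (fderiv ℝ f x).det ≠ 0 := by simpa [D] using hne
    let e := ContinuousLinearMap.toContinuousLinearEquivOfDetNeZero _ hne'
    obtain ⟨w, hw⟩ := e.surjective (f x)
    have hw' : fderiv ℝ f x w = f x := hw
    have := hinner w
    rw [hw', real_inner_self_eq_norm_sq, hfR] at this
    have := pow_pos hR 2
    linarith
  have h1 : (1:ℝ) = ∑ i ∈ Finset.range (Module.finrank ℝ E + 1), c i := by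
    simpa using hP 1 (by simp)
  have h2 : ∫ x in Metric.ball 0 R, D 1 x ∂μ = μ.real (Metric.ball 0 R) := by
    simp_rw [hsum]
    rw [integral_finsetSum _ (fun i _ => (hDi (v i)).const_mul (c i))]
    simp_rw [integral_const_mul, hvol]
    rw [← Finset.sum_mul, ← h1, one_mul]
  simp only [hzero, integral_zero] at h2
  have : 0 < μ.real (Metric.ball (0:E) R) :=
    ENNReal.toReal_pos (Metric.measure_ball_pos μ 0 hR).ne' measure_ball_lt_top.ne
  linarith

/-- a continuous map equal to the identity off a bounded set has a zero -/
lemma aux_zero {E : Type*} [NormedAddCommGroup E] [InnerProductSpace ℝ E] [FiniteDimensional ℝ E]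
    (F : E → E) (hF : Continuous F) (R : ℝ) (hid : ∀ x, R ≤ ‖x‖ → F x = x) : ∃ x, F x = 0 := by
  by_contra! hne
  obtain ⟨G, hG, hGd, hGs⟩ := Continuous.exists_contDiff_approx (f := fun x => F x - x)
    (ε := fun x => ‖F x‖) 1 (by fun_prop) (by fun_prop) (fun x => norm_pos_iff.2 (hne x))
  have hG0 : ∀ x, x + G x ≠ 0 := by
    intro x hx
    have h := hGd x
    rw [dist_eq_norm, eq_neg_of_add_eq_zero_right hx, show -x - (F x - x) = - F x by abel, norm_neg] at h
    exact lt_irrefl _ h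
  have hGR : ∀ x, R ≤ ‖x‖ → G x = 0 := by
    intro x hx
    by_contra h
    exact hGs h (by simp [hid x hx])
  set r := max R 1
  have hr : 0 < r := by positivity
  have hC : ContDiff ℝ 1 (fun x => x + G x) := contDiff_id.add hG
  refine aux_noretract r hr (fun x => (r / ‖x + G x‖) • (x + G x)) ?_ ?_ ?_
  · exact (contDiff_const.div (hC.norm ℝ hG0) (fun x => norm_ne_zero_iff.2 (hG0 x))).smul hC
  · intro x
    have := norm_pos_iff.2 (hG0 x)
    rw [norm_smul, norm_div, norm_norm, Real.norm_of_nonneg hr.le]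
    field_simp
  · intro x hx
    simp only [hGR x (hx ▸ le_max_left _ _), add_zero, hx, div_self hr.ne', one_smul]

/-- If `h` is a continuous self-map of a finite-dimensional real normed space with
`lim_{M→∞} inf_{‖t‖ ≥ M} (‖t‖ - ‖h(t) - t‖) = ∞`, then `h` is surjective. -/
theorem stmt14 {X : Type*} [NormedAddCommGroup X] [NormedSpace ℝ X]
    [FiniteDimensional ℝ X]
    (h : X → X) (hcont : Continuous h)
    (hcoer : ∀ A : ℝ, ∃ M : ℝ, ∀ t : X, M ≤ ‖t‖ → A ≤ ‖t‖ - ‖h t - t‖) :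
    Function.Surjective h := by
  intro y
  obtain ⟨M, hM⟩ := hcoer (‖y‖ + 1)
  let χ : X → ℝ := fun t => max 0 (min 1 (M + 1 - ‖t‖))
  have hχ : Continuous χ := by fun_prop
  let F : X → X := fun t => t + χ t • (h t - t - y)
  have hF : Continuous F := by fun_prop
  have key : ∃ x, F x = 0 := by
    let e : X ≃L[ℝ] EuclideanSpace ℝ (Fin (Module.finrank ℝ X)) := toEuclidean
    obtain ⟨C, hC0, hC⟩ := (e : X →L[ℝ] EuclideanSpace ℝ (Fin (Module.finrank ℝ X))).bound
    obtain ⟨z, hz⟩ := aux_zero (fun z => e (F (e.symm z))) (by fun_prop) (C * (|M| + 1)) (by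
      intro z hz
      have h1 : M + 1 ≤ ‖e.symm z‖ := by
        have := hC (e.symm z)
        simp at this
        have := le_of_mul_le_mul_left (hz.trans this) hC0
        linarith [le_abs_self M]
      have h2 : χ (e.symm z) = 0 := by
        apply max_eq_left
        exact (min_le_right _ _).trans (by linarith)
      simp [F, h2])
    exact ⟨e.symm z, by simpa using hz⟩
  obtain ⟨x, hx⟩ := key
  have hχ0 : 0 ≤ χ x := le_max_left _ _
  have hχ1 : χ x ≤ 1 := max_le zero_le_one (min_le_left _ _)
  have hxM : ‖x‖ < M := by
    by_contra! hle
    have h1 := hM x hle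
    have h2 : x = -(χ x • (h x - x - y)) := eq_neg_of_add_eq_zero_left hx
    have h3 : ‖x‖ ≤ ‖h x - x - y‖ := by
      conv_lhs => rw [h2, norm_neg, norm_smul, Real.norm_of_nonneg hχ0]
      exact mul_le_of_le_one_left (norm_nonneg _) hχ1
    have h4 := norm_sub_le (h x - x) y
    linarith
  have h1 : χ x = 1 := by
    simp only [χ]
    rw [min_eq_left (by linarith)]
    simp
  simp only [F, h1, one_smul] at hx
  refine ⟨x, ?_⟩
  rw [← sub_eq_zero, ← hx]; abel
end
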